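/- Let H be a finite group with normal subgroup Q which is similar to a 3-centralizer in a group of type F₂. Let r be an element of H of order 2 whose image in H/Q lies in O₂(H/Q) but not in the center Z(O₂(H/Q)). Then |C_Q(r)| = 3⁵ and the largest normal 2-subgroup O₂(C_H(r)) of C_H(r) has order 2⁵. -/

import Mathlib

/-- `O_p(X)`: the largest normal `p`-subgroup of the group `X` (for finite `X` this is the
`p`-core), defined as the join of all normal `p`-subgroups. -/
def Op (p : ℕ) (X : Type*) [Group X] : Subgroup X :=
  sSup {P : Subgroup X | P.Normal ∧ IsPGroup p P}

theorem map_conjAut_eq_of_normal {X : Type*} [Group X] (g : X) {P : Subgroup X}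
    (hP : P.Normal) : Subgroup.map (MulAut.conj g).toMonoidHom P = P := by
  ext x
  simp only [Subgroup.mem_map, MulEquiv.coe_toMonoidHom, MulAut.conj_apply]
  constructor
  · rintro ⟨y, hy, rfl⟩
    exact hP.conj_mem y hy g
  · intro hx
    refine ⟨g⁻¹ * x * g, by simpa using hP.conj_mem x hx g⁻¹, by group⟩

instance Op.normal (p : ℕ) (X : Type*) [Group X] : (Op p X).Normal := by
  constructor
  intro n hn g
  have key : Subgroup.map (MulAut.conj g).toMonoidHom (Op p X) = Op p X := by
    unfold Op
    rw [(Subgroup.gc_map_comap _).l_sSup]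
    apply le_antisymm
    · refine iSup_le fun P => iSup_le fun hP => ?_
      rw [map_conjAut_eq_of_normal g hP.1]
      exact le_sSup hP
    · refine sSup_le fun P hP => ?_
      refine le_trans (le_of_eq (map_conjAut_eq_of_normal g hP.1).symm) ?_
      exact le_iSup₂_of_le P hP le_rfl
  rw [← key]
  exact Subgroup.mem_map.mpr ⟨n, hn, by simp⟩

/-- A finite `p`-group is extraspecial if its center, derived subgroup and Frattini subgroup
coincide and have order `p`. -/
def IsExtraspecial (p : ℕ) (P : Type*) [Group P] : Prop :=
  IsPGroup p P ∧ Subgroup.center P = commutator P ∧ Subgroup.center P = frattini P ∧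
    Nat.card (Subgroup.center P) = p

/-- The symplectic group `Sp₄(GF(3))`. -/
abbrev Sp43 := Matrix.symplecticGroup (Fin 2) (ZMod 3)

/-- `PSp₄(3) ≅ Ω₆⁻(2)`, the quotient of `Sp₄(GF(3))` by its center. -/
abbrev PSp43 := Sp43 ⧸ Subgroup.center Sp43

/-- A finite group `H` with a normal subgroup `Q` is similar to a 3-centralizer in a group of
type `M(23)` or `F₂` (Definitions 1.1 and 1.2 of the paper): `Q = F*(H) = O₃(H) ≅ 3^{1+8}_+`
with `Z(Q) = Z(H)`, `O₂(H/Q) ≅ 2^{1+6}_-` with `F*(H/Q) = O₂(H/Q)`, and `(H/Q)/O₂(H/Q)` is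
isomorphic to `PSp₄(3)` (type `F₂`) or to the centralizer of a 3-central element of `PSp₄(3)`
(type `M(23)`). -/
structure SimilarToM23orF2Centralizer (H : Type*) [Group H] [Finite H]
    (Q : Subgroup H) [Q.Normal] : Prop where
  extraspecial : IsExtraspecial 3 Q
  card_eq : Nat.card Q = 3 ^ 9
  exponent3 : ∀ x ∈ Q, x ^ 3 = 1
  centralizer_eq : Subgroup.centralizer (Q : Set H) = Subgroup.center H
  center_le : Subgroup.center H ≤ Q
  O2_extraspecial : IsExtraspecial 2 (Op 2 (H ⧸ Q))
  O2_card : Nat.card (Op 2 (H ⧸ Q)) = 2 ^ 7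
  O2_minusType : ∀ A : Subgroup (H ⧸ Q), A ≤ Op 2 (H ⧸ Q) → (∀ x ∈ A, x ^ 2 = 1) →
    Nat.card A ≤ 2 ^ 3
  O2_selfCentralizing :
    Subgroup.centralizer ((Op 2 (H ⧸ Q)) : Set (H ⧸ Q)) ≤ Op 2 (H ⧸ Q)
  quotient_iso :
    Nonempty (((H ⧸ Q) ⧸ Op 2 (H ⧸ Q)) ≃* PSp43) ∨
    ∃ (z : PSp43) (S : Sylow 3 PSp43), orderOf z = 3 ∧ z ∈ (S : Subgroup PSp43) ∧
      z ∈ Subgroup.centralizer ((S : Subgroup PSp43) : Set PSp43) ∧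
      Nonempty (((H ⧸ Q) ⧸ Op 2 (H ⧸ Q)) ≃* Subgroup.centralizer {z})

/-- A finite group `H` with a normal subgroup `Q` is similar to a 3-centralizer in a group of
type `F₂` (Definition 1.2 of the paper). -/
structure SimilarToF2Centralizer (H : Type*) [Group H] [Finite H]
    (Q : Subgroup H) [Q.Normal] : Prop where
  extraspecial : IsExtraspecial 3 Q
  card_eq : Nat.card Q = 3 ^ 9
  exponent3 : ∀ x ∈ Q, x ^ 3 = 1
  centralizer_eq : Subgroup.centralizer (Q : Set H) = Subgroup.center H
  center_le : Subgroup.center H ≤ Q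
  O2_extraspecial : IsExtraspecial 2 (Op 2 (H ⧸ Q))
  O2_card : Nat.card (Op 2 (H ⧸ Q)) = 2 ^ 7
  O2_minusType : ∀ A : Subgroup (H ⧸ Q), A ≤ Op 2 (H ⧸ Q) → (∀ x ∈ A, x ^ 2 = 1) →
    Nat.card A ≤ 2 ^ 3
  O2_selfCentralizing :
    Subgroup.centralizer ((Op 2 (H ⧸ Q)) : Set (H ⧸ Q)) ≤ Op 2 (H ⧸ Q)
  quotient_iso : Nonempty (((H ⧸ Q) ⧸ Op 2 (H ⧸ Q)) ≃* PSp43)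

theorem f2_indep_core {k ι T A : Type*} [Field k] [Ring A] [Algebra k A] (t t' : T → A)
    (f : ι → A) (hf : ∀ i, f i ≠ 0) (χ : ι → T → k)
    (h : ∀ i y, t y * f i * t' y = χ i y • f i)
    (hχ : ∀ i j, i ≠ j → ∃ y, χ i y ≠ χ j y) : LinearIndependent k f := by
  classical
  rw [linearIndependent_iff']
  intro s
  induction s using Finset.induction_on with
  | empty => simp
  | insert j s hj ih =>
    intro c hc
    have key : ∀ i ∈ s, c i = 0 := by
      intro i hi
      have hij : i ≠ j := fun e => hj (e ▸ hi)
      obtain ⟨y, hy⟩ := hχ i j hij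
      have h1 : ∑ l ∈ insert j s, (c l * χ l y) • f l = 0 := by
        have : t y * (∑ l ∈ insert j s, c l • f l) * t' y = 0 := by rw [hc]; simp
        rw [Finset.mul_sum, Finset.sum_mul] at this
        rw [← this]
        refine Finset.sum_congr rfl fun l _ => ?_
        rw [mul_smul_comm, smul_mul_assoc, h, smul_smul]
      have h2 : ∑ l ∈ insert j s, (c l * (χ l y - χ j y)) • f l = 0 := by
        have : ∑ l ∈ insert j s, (c l * (χ l y - χ j y)) • f l =
            ∑ l ∈ insert j s, (c l * χ l y) • f l - χ j y • ∑ l ∈ insert j s, c l • f l := by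
          rw [Finset.smul_sum, ← Finset.sum_sub_distrib]
          refine Finset.sum_congr rfl fun l _ => ?_
          rw [smul_smul, ← sub_smul]; congr 1; ring
        rw [this, h1, hc]; simp
      rw [Finset.sum_insert hj] at h2
      simp only [sub_self, mul_zero, zero_smul, zero_add] at h2
      have := ih _ h2 i hi
      rcases mul_eq_zero.1 this with h3 | h3
      · exact h3
      · exact absurd (sub_eq_zero.1 h3) hy
    intro i hi
    rcases Finset.mem_insert.1 hi with rfl | hi
    · rw [Finset.sum_insert hj, Finset.sum_eq_zero (fun l hl => by rw [key l hl, zero_smul])] at hc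
      rw [add_zero] at hc
      exact (smul_eq_zero.1 hc).resolve_right (hf i)
    · exact key i hi

section heis
variable {D W : Type*} [Group D] [Finite D] [AddCommGroup W] [Module (ZMod 3) W]
  [Module.Finite (ZMod 3) W] [Nontrivial W]

open Classical in
/-- commutation sign -/
noncomputable def f2sgn (x y : D) : ZMod 3 := if x * y = y * x then 1 else -1

theorem f2_sgn_ne {z : D} (hz : z * z = 1) (hzc : ∀ x, z * x = x * z)
    (hc : ∀ x y : D, x * y = y * x ∨ x * y = z * (y * x))
    (x x' : D) (h : x⁻¹ * x' ∉ Subgroup.center D) : ∃ y, f2sgn x y ≠ f2sgn x' y := by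
  by_contra! hh
  apply h
  rw [Subgroup.mem_center_iff]
  intro y
  have h1 := hh y
  unfold f2sgn at h1
  have n1 : (1 : ZMod 3) ≠ -1 := by decide
  have n2 : (-1 : ZMod 3) ≠ 1 := by decide
  have e : ∀ w, x * y = w * (y * x) → x' * y = w * (y * x') → (∀ u, w * u = u * w) →
      y * (x⁻¹ * x') = x⁻¹ * x' * y := by
    intro w hw hw' hwc
    have : x * (y * (x⁻¹ * x')) = x * (x⁻¹ * x' * y) := by
      rw [← mul_assoc x y, hw]
      simp only [mul_assoc, mul_inv_cancel_left]
      rw [← hw']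
    exact mul_left_cancel this
  by_cases a : x * y = y * x
  · by_cases b : x' * y = y * x'
    · exact e 1 (by simpa using a) (by simpa using b) (by simp)
    · simp [a, b, n1] at h1
  · by_cases b : x' * y = y * x'
    · simp [a, b, n2] at h1
    · exact e z ((hc x y).resolve_left a) ((hc x' y).resolve_left b) hzc

theorem f2_conj {z : D} (hz : z * z = 1) (hzc : ∀ x, z * x = x * z)
    (hc : ∀ x y : D, x * y = y * x ∨ x * y = z * (y * x))
    (σ : D →* Module.End (ZMod 3) W) (hσ : σ z = -1) (x y : D) :
    σ y * σ x * σ y⁻¹ = f2sgn x y • σ x := by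
  unfold f2sgn
  split_ifs with h
  · rw [← map_mul, ← map_mul, ← h]; simp
  · have h' := (hc x y).resolve_left h
    have : y * x * y⁻¹ = z * x := by
      have : z * (x * y) = y * x := by rw [h', ← mul_assoc, hz, one_mul]
      rw [← this]; group
    rw [← map_mul, ← map_mul, this, map_mul, hσ]; simp

theorem f2_unit (σ : D →* Module.End (ZMod 3) W) (x : D) : σ x ≠ 0 := by
  intro h
  have : σ x * σ x⁻¹ = 1 := by rw [← map_mul]; simp
  rw [h, zero_mul] at this
  exact zero_ne_one this

theorem f2_indep {z : D} (hz : z * z = 1) (hzc : ∀ x, z * x = x * z)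
    (hc : ∀ x y : D, x * y = y * x ∨ x * y = z * (y * x))
    (σ : D →* Module.End (ZMod 3) W) (hσ : σ z = -1) :
    LinearIndependent (ZMod 3) (fun i : D ⧸ Subgroup.center D => σ i.out) := by
  refine f2_indep_core (fun y : D => σ y) (fun y : D => σ y⁻¹) _ (fun i => f2_unit σ _)
    (fun i y => f2sgn i.out y) (fun i y => f2_conj hz hzc hc σ hσ _ _) ?_
  intro i j hij
  apply f2_sgn_ne hz hzc hc
  intro h
  apply hij
  rw [← QuotientGroup.out_eq' i, ← QuotientGroup.out_eq' j]
  exact QuotientGroup.eq.2 h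

theorem f2_dim {z : D} (hz : z * z = 1) (hzc : ∀ x, z * x = x * z)
    (hc : ∀ x y : D, x * y = y * x ∨ x * y = z * (y * x))
    (σ : D →* Module.End (ZMod 3) W) (hσ : σ z = -1) :
    Nat.card (D ⧸ Subgroup.center D) ≤ Module.finrank (ZMod 3) W ^ 2 := by
  classical
  haveI : Fintype (D ⧸ Subgroup.center D) := Fintype.ofFinite _
  have := (f2_indep hz hzc hc σ hσ).fintype_card_le_finrank
  rw [Module.finrank_linearMap, ← Nat.card_eq_fintype_card] at this
  rw [sq]; exact this

theorem f2_schur {z : D} (hz : z * z = 1) (hzc : ∀ x, z * x = x * z)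
    (hc : ∀ x y : D, x * y = y * x ∨ x * y = z * (y * x))
    (σ : D →* Module.End (ZMod 3) W) (hσ : σ z = -1)
    (hd : Module.finrank (ZMod 3) W ^ 2 ≤ Nat.card (D ⧸ Subgroup.center D))
    (g : Module.End (ZMod 3) W) (hg : ∀ y : D, σ y * g = g * σ y ∨ σ y * g = - (g * σ y)) :
    g = 0 ∨ ∃ x : D, g = σ x := by
  classical
  haveI : Fintype (D ⧸ Subgroup.center D) := Fintype.ofFinite _
  have hli := f2_indep hz hzc hc σ hσ
  have hdim := le_antisymm (f2_dim hz hzc hc σ hσ) hd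
  have hsp := hli.span_eq_top_of_card_eq_finrank' (by
    rw [Module.finrank_linearMap, ← Nat.card_eq_fintype_card, hdim, sq])
  have hgm : g ∈ Submodule.span (ZMod 3) (Set.range fun i : D ⧸ Subgroup.center D => σ i.out) := by
    rw [hsp]; trivial
  obtain ⟨c, hcg⟩ := (Submodule.mem_span_range_iff_exists_fun _).1 hgm
  have hη : ∀ y, ∃ η : ZMod 3, σ y * g * σ y⁻¹ = η • g := by
    intro y
    have u : σ y * σ y⁻¹ = 1 := by rw [← map_mul]; simp
    rcases hg y with h | h
    · exact ⟨1, by rw [h, mul_assoc, u]; simp⟩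
    · exact ⟨-1, by rw [h, neg_mul, mul_assoc, u]; simp⟩
  have hs : ∀ y, ∃ η : ZMod 3, ∀ i : D ⧸ Subgroup.center D, c i ≠ 0 → f2sgn i.out y = η := by
    intro y
    obtain ⟨η, h⟩ := hη y
    refine ⟨η, fun i hi => ?_⟩
    have h1 : ∑ l : D ⧸ Subgroup.center D, (c l * (f2sgn l.out y - η)) • σ l.out = 0 := by
      have : ∑ l : D ⧸ Subgroup.center D, (c l * (f2sgn l.out y - η)) • σ l.out =
        σ y * g * σ y⁻¹ - η • g := by
        rw [← hcg, Finset.mul_sum, Finset.sum_mul, Finset.smul_sum, ← Finset.sum_sub_distrib]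
        refine Finset.sum_congr rfl fun l _ => ?_
        rw [mul_smul_comm, smul_mul_assoc, f2_conj hz hzc hc σ hσ, smul_smul, smul_smul,
          ← sub_smul]
        congr 1; ring
      rw [this, h, sub_self]
    have := Fintype.linearIndependent_iff.1 hli _ h1 i
    rcases mul_eq_zero.1 this with h3 | h3
    · exact absurd h3 hi
    · exact sub_eq_zero.1 h3
  by_cases h0 : ∀ i, c i = 0
  · left; rw [← hcg]; simp [h0]
  push Not at h0
  obtain ⟨i, hi⟩ := h0
  right
  have hj : ∀ j, j ≠ i → c j = 0 := by
    intro j hji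
    by_contra hcj
    have hn : (j.out)⁻¹ * i.out ∉ Subgroup.center D := by
      intro h
      apply hji
      rw [← QuotientGroup.out_eq' i, ← QuotientGroup.out_eq' j]
      exact QuotientGroup.eq.2 h
    obtain ⟨y, hy⟩ := f2_sgn_ne hz hzc hc _ _ hn
    obtain ⟨η, h⟩ := hs y
    exact hy ((h j hcj).trans (h i hi).symm)
  have hgi : g = c i • σ i.out := by
    rw [← hcg]
    exact Finset.sum_eq_single i (fun j _ h => by rw [hj j h, zero_smul]) (by simp)
  have : ∀ a : ZMod 3, a ≠ 0 → a = 1 ∨ a = -1 := by decide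
  rcases this _ hi with h | h
  · exact ⟨i.out, by rw [hgi, h, one_smul]⟩
  · exact ⟨z * i.out, by rw [hgi, h, map_mul, hσ]; simp⟩
end heis

open Matrix in
theorem f2_sp_blocks (A B C D : Matrix (Fin 2) (Fin 2) (ZMod 3)) :
    fromBlocks A B C D ∈ symplecticGroup (Fin 2) (ZMod 3) ↔
      (B * Aᵀ = A * Bᵀ ∧ B * Cᵀ - A * Dᵀ = -1 ∧ D * Aᵀ - C * Bᵀ = 1 ∧ D * Cᵀ = C * Dᵀ) := by
  rw [SymplecticGroup.mem_iff, J, fromBlocks_transpose, fromBlocks_multiply, fromBlocks_multiply,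
    fromBlocks_inj]
  simp [← sub_eq_add_neg, sub_eq_zero]

/-- the parametrised stabiliser of the first row -/
def f2pm (p : (ZMod 3 × ZMod 3 × ZMod 3) × (ZMod 3 × ZMod 3 × ZMod 3 × ZMod 3)) :
    Matrix (Fin 2 ⊕ Fin 2) (Fin 2 ⊕ Fin 2) (ZMod 3) :=
  let c1 := p.1.1
  let c2 := p.1.2.1
  let c4 := p.1.2.2
  let a := p.2.1
  let b := p.2.2.1
  let c := p.2.2.2.1
  let d := p.2.2.2.2
  Matrix.fromBlocks !![1, 0; -a * c4 + b * c2, a] !![0, 0; 0, b]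
    !![c1, c2; -c * c4 + d * c2, c] !![1, c4; 0, d]

theorem f2pm_mem (p) (hp : p.2.1 * p.2.2.2.2 - p.2.2.1 * p.2.2.2.1 = 1) :
    f2pm p ∈ Matrix.symplecticGroup (Fin 2) (ZMod 3) := by
  obtain ⟨⟨c1, c2, c4⟩, a, b, c, d⟩ := p
  simp only at hp
  unfold f2pm
  rw [f2_sp_blocks]
  refine ⟨?_, ?_, ?_, ?_⟩ <;> ext i j <;> fin_cases i <;> fin_cases j <;>
    simp [Matrix.vecMul, dotProduct, Fin.sum_univ_two] <;> first | ring1 | linear_combination hp | linear_combination -hp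

theorem f2_trans (v : Fin 2 ⊕ Fin 2 → ZMod 3) (hv : v ≠ 0) :
    ∃ A : Sp43, A.1 (Sum.inl 0) = v := by
  have h1 : ∀ x1 x2 : ZMod 3, ¬ (x1 = 0 ∧ x2 = 0) → ∃ a b : ZMod 3, x1 * a - x2 * b = 1 := by
    decide
  have h2 : ∀ x1 x2 y1 y2 : ZMod 3, ¬ (x1 = 0 ∧ x2 = 0) →
    ∃ s t u : ZMod 3, x1 * s + x2 * t = y1 ∧ x1 * t + x2 * u = y2 := by
    decide
  have key : ∀ x1 x2 y1 y2 : ZMod 3, ¬ (x1 = 0 ∧ x2 = 0) →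
      ∃ A : Sp43, A.1 (Sum.inl 0) = Sum.elim ![x1, x2] ![y1, y2] := by
    intro x1 x2 y1 y2 hx
    obtain ⟨a, b, hab⟩ := h1 x1 x2 hx
    obtain ⟨s, t, u, h, h'⟩ := h2 x1 x2 y1 y2 hx
    refine ⟨⟨Matrix.fromBlocks !![x1, x2; b, a] !![y1, y2; b * s + a * t, b * t + a * u]
      0 !![a, -b; -x2, x1], ?_⟩, ?_⟩
    · rw [f2_sp_blocks]
      subst h h'
      refine ⟨?_, ?_, ?_, ?_⟩ <;> ext i j <;> fin_cases i <;> fin_cases j <;>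
        simp [Matrix.vecMul, dotProduct, Fin.sum_univ_two] <;> first | ring1 | linear_combination hab | linear_combination -hab
    · ext (i | i) <;> fin_cases i <;> simp
  by_cases h : v (Sum.inl 0) = 0 ∧ v (Sum.inl 1) = 0
  · obtain ⟨A, hA⟩ := key (-v (Sum.inr 0)) (-v (Sum.inr 1)) 0 0 (by
      rintro ⟨e1, e2⟩
      apply hv
      ext (i | i) <;> fin_cases i <;> simp_all)
    refine ⟨A * ⟨Matrix.J (Fin 2) (ZMod 3), SymplecticGroup.J_mem _ _⟩, ?_⟩
    ext j
    change (A.1 * Matrix.J (Fin 2) (ZMod 3)) (Sum.inl 0) j = v j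
    rw [Matrix.mul_apply, hA]
    rcases j with j | j <;> fin_cases j <;> simp [Matrix.J, h]
  · obtain ⟨A, hA⟩ := key _ _ (v (Sum.inr 0)) (v (Sum.inr 1)) h
    refine ⟨A, hA.trans ?_⟩
    ext (i | i) <;> fin_cases i <;> simp

theorem f2_sp_card : 51840 ≤ Nat.card Sp43 := by
  choose a ha using f2_trans
  let P := {p : (ZMod 3 × ZMod 3 × ZMod 3) × (ZMod 3 × ZMod 3 × ZMod 3 × ZMod 3) //
    p.2.1 * p.2.2.2.2 - p.2.2.1 * p.2.2.2.1 = 1}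
  let F : {v : Fin 2 ⊕ Fin 2 → ZMod 3 // v ≠ 0} × P → Sp43 :=
    fun q => ⟨f2pm q.2.1, f2pm_mem _ q.2.2⟩ * a q.1.1 q.1.2
  have hF : Function.Injective F := by
    have row : ∀ q, (F q).1 (Sum.inl 0) = q.1.1 := by
      rintro ⟨⟨v, hv⟩, p⟩
      ext j
      change (f2pm p.1 * (a v hv).1) (Sum.inl 0) j = v j
      rw [Matrix.mul_apply, Fintype.sum_eq_single (Sum.inl 0)]
      · rw [ha]; simp [f2pm]
      · rintro (i | i) hi <;> fin_cases i <;> simp_all [f2pm]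
    intro q q' h
    have e1 : q.1 = q'.1 := Subtype.ext (by rw [← row q, ← row q', h])
    obtain ⟨v, p⟩ := q
    obtain ⟨v', p'⟩ := q'
    simp only at e1
    subst e1
    have h2 := congrArg Subtype.val (mul_right_cancel h)
    simp only at h2
    have g : ∀ i j, f2pm p.1 i j = f2pm p'.1 i j := fun i j => by rw [h2]
    have e : p = p' := by
      obtain ⟨⟨⟨c1, c2, c4⟩, a, b, c, d⟩, hp⟩ := p
      obtain ⟨⟨⟨c1', c2', c4'⟩, a', b', c', d'⟩, hp'⟩ := p'
      have g1 := g (Sum.inr 0) (Sum.inl 0)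
      have g2 := g (Sum.inr 0) (Sum.inl 1)
      have g3 := g (Sum.inr 0) (Sum.inr 1)
      have g4 := g (Sum.inl 1) (Sum.inl 1)
      have g5 := g (Sum.inl 1) (Sum.inr 1)
      have g6 := g (Sum.inr 1) (Sum.inl 1)
      have g7 := g (Sum.inr 1) (Sum.inr 1)
      simp [f2pm] at g1 g2 g3 g4 g5 g6 g7
      subst g1 g2 g3 g4 g5 g6 g7
      rfl
    rw [e]
  have := Nat.card_le_card_of_injective F hF
  refine le_trans (le_of_eq ?_) this
  rw [Nat.card_prod]
  have c1 : Nat.card {v : Fin 2 ⊕ Fin 2 → ZMod 3 // v ≠ 0} = 80 := by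
    rw [Nat.card_eq_fintype_card, Fintype.card_subtype_compl]
    simp [ZMod.card]
  have c2 : Nat.card P = 27 * 24 := by
    let e : P ≃ (ZMod 3 × ZMod 3 × ZMod 3) ×
      {q : ZMod 3 × ZMod 3 × ZMod 3 × ZMod 3 // q.1 * q.2.2.2 - q.2.1 * q.2.2.1 = 1} :=
      { toFun := fun p => (p.1.1, ⟨p.1.2, p.2⟩)
        invFun := fun p => ⟨(p.1, p.2.1), p.2.2⟩
        left_inv := fun p => rfl
        right_inv := fun p => rfl }
    rw [Nat.card_congr e, Nat.card_prod]
    congr 1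
    · simp [Nat.card_prod]
    · rw [Nat.card_eq_fintype_card]
      decide
  rw [c1, c2]

open Matrix in
theorem f2_sp_center : Nat.card (Subgroup.center Sp43) ≤ 2 := by
  have mem : ∀ S : Matrix (Fin 2) (Fin 2) (ZMod 3), Sᵀ = S →
      Matrix.fromBlocks 1 S 0 1 ∈ Matrix.symplecticGroup (Fin 2) (ZMod 3) := by
    intro S hS; rw [f2_sp_blocks]; simp [hS]
  have mem' : ∀ S : Matrix (Fin 2) (Fin 2) (ZMod 3), Sᵀ = S →
      Matrix.fromBlocks 1 0 S 1 ∈ Matrix.symplecticGroup (Fin 2) (ZMod 3) := by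
    intro S hS; rw [f2_sp_blocks]; simp [hS]
  have key : ∀ M ∈ Subgroup.center Sp43, ∃ e : ({1, -1} : Finset (ZMod 3)),
      M.1 = (e : ZMod 3) • (1 : Matrix (Fin 2 ⊕ Fin 2) (Fin 2 ⊕ Fin 2) (ZMod 3)) := by
    intro M hM
    rw [Subgroup.mem_center_iff] at hM
    obtain ⟨A, B, C, D, hABCD⟩ : ∃ A B C D, M.1 = Matrix.fromBlocks A B C D :=
      ⟨_, _, _, _, (Matrix.fromBlocks_toBlocks M.1).symm⟩
    have hm : M.1 ∈ Matrix.symplecticGroup (Fin 2) (ZMod 3) := M.2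
    rw [hABCD, f2_sp_blocks] at hm
    have h1 : ∀ S : Matrix (Fin 2) (Fin 2) (ZMod 3), Sᵀ = S → S * C = 0 ∧ S * D = A * S := by
      intro S hS
      have := congrArg Subtype.val (hM ⟨_, mem S hS⟩)
      change Matrix.fromBlocks 1 S 0 1 * M.1 = M.1 * Matrix.fromBlocks 1 S 0 1 at this
      rw [hABCD, Matrix.fromBlocks_multiply, Matrix.fromBlocks_multiply, Matrix.fromBlocks_inj] at this
      simp at this
      exact ⟨this.1, by have := this.2.1; rw [add_comm] at this; exact add_right_cancel this⟩
    have h2 : ∀ S : Matrix (Fin 2) (Fin 2) (ZMod 3), Sᵀ = S → B * S = 0 := by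
      intro S hS
      have := congrArg Subtype.val (hM ⟨_, mem' S hS⟩)
      change Matrix.fromBlocks 1 0 S 1 * M.1 = M.1 * Matrix.fromBlocks 1 0 S 1 at this
      rw [hABCD, Matrix.fromBlocks_multiply, Matrix.fromBlocks_multiply, Matrix.fromBlocks_inj] at this
      simp at this
      exact this.1
    have hC : C = 0 := by simpa using (h1 1 (by simp)).1
    have hB : B = 0 := by simpa using h2 1 (by simp)
    have hD : D = A := by simpa using (h1 1 (by simp)).2
    subst hC hB hD
    have k1 := (h1 !![1, 0; 0, 0] (by ext i j; fin_cases i <;> fin_cases j <;> rfl)).2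
    have k2 := (h1 !![0, 1; 1, 0] (by ext i j; fin_cases i <;> fin_cases j <;> rfl)).2
    have a01 : D 0 1 = 0 := by simpa [Matrix.mul_apply] using congrFun (congrFun k1 0) 1
    have a10 : D 1 0 = 0 := by simpa [Matrix.mul_apply] using (congrFun (congrFun k1 1) 0).symm
    have a11 : D 1 1 = D 0 0 := by simpa [Matrix.mul_apply] using congrFun (congrFun k2 0) 1
    have hDs : D = D 0 0 • (1 : Matrix (Fin 2) (Fin 2) (ZMod 3)) := by
      ext i j; fin_cases i <;> fin_cases j <;> simp [a01, a10, a11]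
    have hsq : D 0 0 * D 0 0 = 1 := by
      have := congrFun (congrFun hm.2.2.1 0) 0
      simpa [Matrix.mul_apply, a01] using this
    refine ⟨⟨D 0 0, ?_⟩, ?_⟩
    · have : ∀ x : ZMod 3, x * x = 1 → x ∈ ({1, -1} : Finset (ZMod 3)) := by decide
      exact this _ hsq
    · rw [hABCD]
      rw [← Matrix.fromBlocks_one, Matrix.fromBlocks_smul, smul_zero, ← hDs]
  choose e he using key
  have := Nat.card_le_card_of_injective (fun M : Subgroup.center Sp43 => e M.1 M.2) (by
    intro M M' h
    apply Subtype.ext; apply Subtype.ext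
    rw [he M.1 M.2, he M'.1 M'.2]
    simp only at h
    rw [h])
  refine this.trans ?_
  rw [Nat.card_eq_fintype_card, Fintype.card_coe]; decide

theorem f2_psp_card : 25920 ≤ Nat.card PSp43 := by
  have h := Subgroup.card_eq_card_quotient_mul_card_subgroup (Subgroup.center Sp43)
  have h1 := f2_sp_card
  have h2 := f2_sp_center
  have : Nat.card Sp43 ≤ Nat.card PSp43 * 2 := by rw [h]; exact Nat.mul_le_mul_left _ h2
  omega

structure F2E {G : Type*} [Group G] (E : Subgroup G) (z r : G) : Prop where
  nE : E.Normal
  cE : Nat.card E = 128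
  zE : z ∈ E
  z1 : z ≠ 1
  zz : z * z = 1
  zc : ∀ g, z * g = g * z
  comm : ∀ x ∈ E, ∀ y ∈ E, x * y = y * x ∨ x * y = z * (y * x)
  sq : ∀ x ∈ E, x * x = 1 ∨ x * x = z
  cen : ∀ x ∈ E, (∀ y ∈ E, x * y = y * x) → x = 1 ∨ x = z
  minus : ∀ A : Subgroup G, A ≤ E → (∀ x ∈ A, x * x = 1) → Nat.card A ≤ 8
  rE : r ∈ E
  r1 : r ≠ 1
  rz : r ≠ z
  rr : r * r = 1

/-- membership in the four-group generated by `z` and `r` -/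
def f2P {G : Type*} [Group G] (z r g : G) : Prop := g = 1 ∨ g = z ∨ g = r ∨ g = z * r

section cnt
set_option linter.unusedSectionVars false
variable {G : Type*} [Group G] [Finite G]

theorem f2_nc (P : Subgroup G) : Nat.card P = (P : Set G).ncard :=
  Nat.card_coe_set_eq (P : Set G)

theorem f2_ext (P : Subgroup G) (hP : ∀ a ∈ P, a * a = 1) (x : G) (hx : x * x = 1)
    (hc : ∀ a ∈ P, x * a = a * x) (hn : x ∉ P) :
    ∃ P' : Subgroup G, (∀ a, a ∈ P' ↔ a ∈ P ∨ x * a ∈ P) ∧ (∀ a ∈ P', a * a = 1) ∧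
      Nat.card P' = 2 * Nat.card P := by
  have hxx : ∀ a, x * (x * a) = a := fun a => by rw [← mul_assoc, hx, one_mul]
  have hinv : ∀ a : G, a * a = 1 → a⁻¹ = a := fun a h => inv_eq_of_mul_eq_one_left h
  have hsq : ∀ a, a ∈ P ∨ x * a ∈ P → a * a = 1 := by
    rintro a (h | h)
    · exact hP a h
    · have := hP _ h
      have h2 : a * x = x * a := by
        have := hc _ h
        rw [hxx] at this
        have h3 := congrArg (x * ·) this
        simp only [mul_assoc, hxx] at h3
        exact h3.symm
      rw [mul_assoc, ← mul_assoc a, h2, mul_assoc, hxx] at this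
      exact this
  let P' : Subgroup G :=
    { carrier := {a | a ∈ P ∨ x * a ∈ P}
      one_mem' := Or.inl P.one_mem
      mul_mem' := by
        rintro a b (ha | ha) (hb | hb)
        · exact Or.inl (P.mul_mem ha hb)
        · right
          rw [← mul_assoc, hc a ha, mul_assoc]; exact P.mul_mem ha hb
        · right; rw [← mul_assoc]; exact P.mul_mem ha hb
        · left
          have := P.mul_mem ha hb
          have h2 := hc _ ha
          rw [hxx] at h2
          rwa [← mul_assoc, ← h2] at this
      inv_mem' := by
        intro a ha
        rw [hinv a (hsq a ha)]; exact ha }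
  refine ⟨P', fun a => Iff.rfl, hsq, ?_⟩
  have e : (P' : Set G) = (P : Set G) ∪ (x * ·) '' (P : Set G) := by
    ext a
    constructor
    · rintro (h | h)
      · exact Or.inl h
      · exact Or.inr ⟨_, h, hxx a⟩
    · rintro (h | ⟨b, h, rfl⟩)
      · exact Or.inl h
      · right; simp only [hxx]; exact h
  have hd : Disjoint (P : Set G) ((x * ·) '' (P : Set G)) := by
    rw [Set.disjoint_left]
    rintro a ha ⟨b, hb, rfl⟩
    apply hn
    have := P.mul_mem ha (P.inv_mem hb)
    simpa using this
  have : (P' : Set G).ncard = 2 * (P : Set G).ncard := by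
    rw [e, Set.ncard_union_eq hd (Set.toFinite _) (Set.toFinite _),
      Set.ncard_image_of_injective _ (mul_right_injective x)]; ring
  rwa [f2_nc, f2_nc]

variable {E : Subgroup G} {z r : G}

theorem F2E.minus' (h : F2E E z r) (x y : G) (hx : x ∈ E) (hy : y ∈ E) (hxx : x * x = 1)
    (hyy : y * y = 1) (hxy : x * y = y * x) (hxr : x * r = r * x) (hyr : y * r = r * y)
    (hxP : ¬ f2P z r x) : f2P z r y ∨ f2P z r (x * y) := by
  by_contra! hcon
  obtain ⟨A1, m1, s1, c1⟩ := f2_ext (⊥ : Subgroup G) (by simp) z h.zz (by simp)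
    (by simpa using h.z1)
  have m1' : ∀ a, a ∈ A1 ↔ a = 1 ∨ a = z := fun a => by
    rw [m1]
    simp only [Subgroup.mem_bot]
    refine or_congr_right ⟨fun e => ?_, fun e => by rw [e, h.zz]⟩
    exact mul_left_cancel (e.trans h.zz.symm)
  obtain ⟨A2, m2, s2, c2⟩ := f2_ext A1 s1 r h.rr
    (fun a ha => by rcases (m1' a).1 ha with rfl | rfl; · simp
                    · exact (h.zc r).symm)
    (by rw [m1']; exact not_or.2 ⟨h.r1, h.rz⟩)
  have m2' : ∀ a, a ∈ A2 ↔ f2P z r a := fun a => by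
    rw [m2, m1', m1', or_assoc]
    refine or_congr_right (or_congr_right (or_congr ⟨fun e => ?_, fun e => by rw [e, h.rr]⟩
      ⟨fun e => ?_, fun e => ?_⟩))
    · exact mul_left_cancel (e.trans h.rr.symm)
    · rw [h.zc, ← e, ← mul_assoc, h.rr, one_mul]
    · rw [e, h.zc, ← mul_assoc, h.rr, one_mul]
  have com2 : ∀ w, w * r = r * w → ∀ a ∈ A2, w * a = a * w := by
    intro w hw a ha
    rcases (m2' a).1 ha with rfl | rfl | rfl | rfl
    · simp
    · exact (h.zc _).symm
    · exact hw
    · rw [← mul_assoc, ← h.zc, mul_assoc, hw, mul_assoc]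
  obtain ⟨A3, m3, s3, c3⟩ := f2_ext A2 s2 x hxx (com2 x hxr) (by rwa [m2'])
  obtain ⟨A4, m4, s4, c4⟩ := f2_ext A3 s3 y hyy (by
    intro a ha
    rcases (m3 a).1 ha with ha | ha
    · exact com2 y hyr a ha
    · have := com2 y hyr _ ha
      rw [← mul_assoc, ← hxy, mul_assoc, mul_assoc] at this
      exact mul_left_cancel this) (by rw [m3, m2', m2']; exact not_or.2 hcon)
  have := h.minus A4 (by
    have hA1 : A1 ≤ E := fun a ha => by
      rcases (m1' a).1 ha with rfl | rfl
      · exact E.one_mem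
      · exact h.zE
    have st : ∀ (A A' : Subgroup G) (w : G), (∀ a, a ∈ A' ↔ a ∈ A ∨ w * a ∈ A) → w ∈ E → A ≤ E →
        A' ≤ E := by
      intro A A' w hm hw hA a ha
      rcases (hm a).1 ha with ha | ha
      · exact hA ha
      · exact (E.mul_mem_cancel_left hw).1 (hA ha)
    exact st _ _ _ m4 hy (st _ _ _ m3 hx (st _ _ _ m2 h.rE hA1))) s4
  rw [c4, c3, c2, c1] at this
  simp at this

/-- involutions not commuting with `a` -/
theorem f2_flip (D : Subgroup G) (hz1 : z ≠ 1) (hzz : z * z = 1) (zc : ∀ g, z * g = g * z)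
    (comm : ∀ x ∈ D, ∀ y ∈ D, x * y = y * x ∨ x * y = z * (y * x))
    (a : G) (ha : a ∈ D) (haa : a * a = 1) :
    4 * {x | x ∈ D ∧ x * x = 1 ∧ x * a ≠ a * x}.ncard ≤ Nat.card D := by
  set T := {x | x ∈ D ∧ x * x = 1 ∧ x * a ≠ a * x} with hT
  rcases T.eq_empty_or_nonempty with h0 | ⟨e, he⟩
  · simp [h0]
  have hz : ∀ x ∈ D, x * a ≠ a * x → x * a = z * (a * x) := fun x hx h =>
    (comm x hx a ha).resolve_left h
  have hz' : ∀ x ∈ D, x * a ≠ a * x → a * x = z * (x * a) := fun x hx h =>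
    (comm a ha x hx).resolve_left (Ne.symm h)
  let N := {x | x ∈ D ∧ x * a ≠ a * x}
  let Y := {x | x ∈ D ∧ x * a = a * x}
  let T' := {x | x ∈ D ∧ x * x ≠ 1 ∧ x * a ≠ a * x}
  have e1 : T.ncard ≤ T'.ncard := by
    refine Set.ncard_le_ncard_of_injOn (· * a) ?_ (fun x _ y _ h => mul_right_cancel h)
      (Set.toFinite _)
    rintro x ⟨hx, hxx, hxa⟩
    refine ⟨D.mul_mem hx ha, ?_, ?_⟩
    · change x * a * (x * a) ≠ 1
      have : x * a * (x * a) = z := by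
        rw [mul_assoc, ← mul_assoc a, hz' x hx hxa, mul_assoc, mul_assoc, haa, mul_one, zc,
          ← mul_assoc, hxx, one_mul]
      rw [this]; exact hz1
    · intro h
      simp only [← mul_assoc] at h
      exact hxa (mul_right_cancel h)
  have e2 : T.ncard + T'.ncard = N.ncard := by
    rw [← Set.ncard_union_eq _ (Set.toFinite _) (Set.toFinite _)]
    · congr 1; ext x
      simp only [T, T', N, Set.mem_union, Set.mem_ofPred_eq]; tauto
    · rw [Set.disjoint_left]; rintro x ⟨_, h, _⟩ ⟨_, h', _⟩; exact h' h
  have e3 : N.ncard ≤ Y.ncard := by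
    refine Set.ncard_le_ncard_of_injOn (e * ·) ?_ (fun x _ y _ h => mul_left_cancel h)
      (Set.toFinite _)
    rintro x ⟨hx, hxa⟩
    refine ⟨D.mul_mem he.1 hx, ?_⟩
    change e * x * a = a * (e * x)
    rw [mul_assoc, hz x hx hxa, ← mul_assoc a, hz' e he.1 he.2.2, mul_assoc, ← mul_assoc e,
      ← zc e]
    simp only [mul_assoc]
  have e4 : N.ncard + Y.ncard = Nat.card D := by
    have : Nat.card D = (D : Set G).ncard := f2_nc _
    rw [this, ← Set.ncard_union_eq _ (Set.toFinite _) (Set.toFinite _)]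
    · congr 1; ext x
      simp only [N, Y, Set.mem_union, Set.mem_ofPred_eq, SetLike.mem_coe]; tauto
    · rw [Set.disjoint_left]; rintro x ⟨_, h⟩ ⟨_, h'⟩; exact h h'
  omega

theorem F2E.exists_e (h : F2E E z r) : ∃ e ∈ E, e * r = z * (r * e) ∧ e * r ≠ r * e := by
  by_contra! hcon
  rcases h.cen r h.rE (fun y hy => by
    rcases h.comm y hy r h.rE with h1 | h1
    · exact h1.symm
    · exact (hcon y hy h1).symm) with h1 | h1
  · exact h.r1 h1
  · exact h.rz h1

theorem F2E.D_card (h : F2E E z r) :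
    Nat.card (E ⊓ Subgroup.centralizer {r} : Subgroup G) = 64 := by
  obtain ⟨e, he, her, hne⟩ := h.exists_e
  have hz : ∀ x ∈ E, x * r ≠ r * x → x * r = z * (r * x) := fun x hx h' =>
    (h.comm x hx r h.rE).resolve_left h'
  have her' : r * e = z * (e * r) := by rw [her, ← mul_assoc, h.zz, one_mul]
  let N := {x | x ∈ E ∧ x * r ≠ r * x}
  let Y := {x | x ∈ E ∧ x * r = r * x}
  have hY : Nat.card (E ⊓ Subgroup.centralizer {r} : Subgroup G) = Y.ncard := by
    have : ((E ⊓ Subgroup.centralizer {r} : Subgroup G) : Set G) = Y := by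
      ext x
      simp only [Y, Subgroup.coe_inf, Set.mem_inter_iff, SetLike.mem_coe,
        Subgroup.mem_centralizer_singleton_iff, Set.mem_ofPred_eq]
    rw [← this]; exact f2_nc _
  have e3 : N.ncard ≤ Y.ncard := by
    refine Set.ncard_le_ncard_of_injOn (e * ·) ?_ (fun x _ y _ h => mul_left_cancel h)
      (Set.toFinite _)
    rintro x ⟨hx, hxa⟩
    refine ⟨E.mul_mem he hx, ?_⟩
    change e * x * r = r * (e * x)
    rw [mul_assoc, hz x hx hxa, ← mul_assoc r, her', mul_assoc, ← mul_assoc e,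
      ← h.zc e]
    simp only [mul_assoc]
  have e3' : Y.ncard ≤ N.ncard := by
    refine Set.ncard_le_ncard_of_injOn (e * ·) ?_ (fun x _ y _ h => mul_left_cancel h)
      (Set.toFinite _)
    rintro x ⟨hx, hxa⟩
    refine ⟨E.mul_mem he hx, ?_⟩
    change e * x * r ≠ r * (e * x)
    rw [mul_assoc, hxa, ← mul_assoc, ← mul_assoc]
    intro h'
    exact hne (mul_right_cancel h')
  have e4 : N.ncard + Y.ncard = Nat.card E := by
    have : Nat.card E = (E : Set G).ncard := f2_nc _
    rw [this, ← Set.ncard_union_eq _ (Set.toFinite _) (Set.toFinite _)]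
    · congr 1; ext x
      simp only [N, Y, Set.mem_union, Set.mem_ofPred_eq, SetLike.mem_coe]; tauto
    · rw [Set.disjoint_left]; rintro x ⟨_, h⟩ ⟨_, h'⟩; exact h h'
  rw [h.cE] at e4
  omega

theorem F2E.D_cen (h : F2E E z r) (x : G) (hx : x ∈ E) (hxr : x * r = r * x)
    (hc : ∀ y ∈ E, y * r = r * y → x * y = y * x) : f2P z r x := by
  obtain ⟨e, he, her, hne⟩ := h.exists_e
  have her' : r * e = z * (e * r) := by rw [her, ← mul_assoc, h.zz, one_mul]
  -- an element commuting with `D` and `e` is central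
  have key : ∀ w ∈ E, (∀ y ∈ E, y * r = r * y → w * y = y * w) → w * e = e * w →
      w = 1 ∨ w = z := by
    intro w hw hwc hwe
    refine h.cen w hw fun y hy => ?_
    rcases h.comm y hy r h.rE with h1 | h1
    · exact hwc y hy h1
    · have h2 := hwc (e * y) (E.mul_mem he hy) (by
        rw [mul_assoc, h1, ← mul_assoc r, her', mul_assoc, ← mul_assoc e, ← h.zc e]
        simp only [mul_assoc])
      rw [← mul_assoc, hwe, mul_assoc, mul_assoc] at h2
      exact mul_left_cancel h2
  rcases h.comm x hx e he with h1 | h1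
  · rcases key x hx hc h1 with h2 | h2
    · exact Or.inl h2
    · exact Or.inr (Or.inl h2)
  · have := key (x * r) (E.mul_mem hx h.rE) (fun y hy hyr => by
      rw [mul_assoc, ← hyr, ← mul_assoc, hc y hy hyr, mul_assoc]) (by
      have h5 : x * (z * (e * r)) = z * ((x * e) * r) := by
        rw [← mul_assoc x z, ← h.zc x]; simp only [mul_assoc]
      rw [mul_assoc, her', h5, h1]
      simp only [mul_assoc]
      rw [← mul_assoc z z, h.zz, one_mul])
    rcases this with h2 | h2
    · right; right; left
      exact mul_right_cancel (h2.trans h.rr.symm)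
    · right; right; right
      rw [← h2, mul_assoc, h.rr, mul_one]

theorem f2P_card (z r : G) : {x | f2P z r x}.ncard ≤ 4 := by
  classical
  have : {x | f2P z r x} = (({1, z, r, z * r} : Finset G) : Set G) := by
    ext x; simp [f2P]
  rw [this, Set.ncard_coe_finset]
  exact Finset.card_le_four

theorem F2E.D_inv (h : F2E E z r) :
    {x | x ∈ E ∧ x * x = 1 ∧ x * r = r * x}.ncard ≤ 24 := by
  set T := {x | x ∈ E ∧ x * x = 1 ∧ x * r = r * x} with hT
  by_cases h0 : ∀ x ∈ T, f2P z r x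
  · have : T.ncard ≤ 4 := (Set.ncard_le_ncard h0 (Set.toFinite _)).trans (f2P_card z r)
    omega
  push Not at h0
  obtain ⟨a, ⟨haE, haa, har⟩, haP⟩ := h0
  have h1 := f2_flip (E ⊓ Subgroup.centralizer {r} : Subgroup G) h.z1 h.zz h.zc
    (fun x hx y hy => h.comm x hx.1 y hy.1) a
    ⟨haE, Subgroup.mem_centralizer_singleton_iff.2 har⟩ haa
  rw [h.D_card] at h1
  set T1 := {x | x ∈ (E ⊓ Subgroup.centralizer {r} : Subgroup G) ∧ x * x = 1 ∧ x * a ≠ a * x}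
  have h2 : T ⊆ T1 ∪ ({x | f2P z r x} ∪ (a * ·) '' {x | f2P z r x}) := by
    rintro x ⟨hxE, hxx, hxr⟩
    by_cases hxa : x * a = a * x
    · right
      rcases h.minus' a x haE hxE haa hxx hxa.symm har hxr haP with h3 | h3
      · exact Or.inl h3
      · exact Or.inr ⟨a * x, h3, by simp only [← mul_assoc, haa, one_mul]⟩
    · left
      exact ⟨⟨hxE, Subgroup.mem_centralizer_singleton_iff.2 hxr⟩, hxx, hxa⟩
  have h3 := Set.ncard_le_ncard h2 (Set.toFinite _)
  have h4 := Set.ncard_union_le T1 ({x | f2P z r x} ∪ (a * ·) '' {x | f2P z r x})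
  have h5 := Set.ncard_union_le {x | f2P z r x} ((a * ·) '' {x | f2P z r x})
  have h6 : ((a * ·) '' {x | f2P z r x}).ncard ≤ _ := Set.ncard_image_le (Set.toFinite _)
  have h7 := f2P_card z r
  omega

theorem F2E.orbit (h : F2E E z r) :
    Nat.card G ≤ 54 * Nat.card (Subgroup.centralizer {r}) := by
  have h1 := f2_flip E h.z1 h.zz h.zc h.comm r h.rE h.rr
  rw [h.cE] at h1
  have h2 := h.D_inv
  have hT : {x | x ∈ E ∧ x * x = 1}.ncard ≤ 56 := by
    have : {x | x ∈ E ∧ x * x = 1} ⊆ {x | x ∈ E ∧ x * x = 1 ∧ x * r ≠ r * x} ∪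
      {x | x ∈ E ∧ x * x = 1 ∧ x * r = r * x} := by
      intro x hx
      by_cases h3 : x * r = r * x
      · exact Or.inr ⟨hx.1, hx.2, h3⟩
      · exact Or.inl ⟨hx.1, hx.2, h3⟩
    have := (Set.ncard_le_ncard this (Set.toFinite _)).trans (Set.ncard_union_le _ _)
    omega
  have ho : (MulAction.orbit (ConjAct G) r).ncard ≤ 54 := by
    have h3 : ({1, z} : Set G) ∪ MulAction.orbit (ConjAct G) r ⊆ {x | x ∈ E ∧ x * x = 1} := by
      rintro x ((rfl | rfl) | ⟨g, rfl⟩)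
      · exact ⟨E.one_mem, by simp⟩
      · exact ⟨h.zE, h.zz⟩
      · refine ⟨h.nE.conj_mem r h.rE (ConjAct.ofConjAct g), ?_⟩
        simp only [ConjAct.smul_def]
        have : ∀ u : G, u * r * u⁻¹ * (u * r * u⁻¹) = u * (r * r) * u⁻¹ := fun u => by group
        rw [this, h.rr]; simp
    have h4 := Set.ncard_le_ncard h3 (Set.toFinite _)
    rw [Set.ncard_union_eq _ (Set.toFinite _) (Set.toFinite _), Set.ncard_pair (Ne.symm h.z1)] at h4
    · omega
    · rw [Set.disjoint_left]
      have cj : ∀ (g : ConjAct G), g • r = 1 ∨ g • r = z → False := by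
        intro g hg
        rw [ConjAct.smul_def] at hg
        set u := ConjAct.ofConjAct g
        have er : r = u⁻¹ * (u * r * u⁻¹) * u := by group
        rcases hg with hg | hg
        · rw [hg] at er; exact h.r1 (by simpa using er)
        · rw [hg, mul_assoc, h.zc, ← mul_assoc] at er; exact h.rz (by simpa using er)
      rintro x (rfl | rfl) ⟨g, hg⟩
      · exact cj g (Or.inl hg)
      · exact cj g (Or.inr hg)
  have h5 : Nat.card (MulAction.orbit (ConjAct G) r) * Nat.card (MulAction.stabilizer (ConjAct G) r)
      = Nat.card (ConjAct G) := by
    rw [← Nat.card_prod]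
    exact Nat.card_congr (MulAction.orbitProdStabilizerEquivGroup (ConjAct G) r)
  have h6 : Nat.card (MulAction.stabilizer (ConjAct G) r) = Nat.card (Subgroup.centralizer {r}) := by
    rw [ConjAct.stabilizer_eq_centralizer]
    rfl
  have h7 : Nat.card (ConjAct G) = Nat.card G := rfl
  rw [← h7, ← h5, h6, Nat.card_coe_set_eq]
  exact Nat.mul_le_mul_right _ ho

end cnt

structure F2D {C : Type*} [Group C] (D : Subgroup C) (z r : C) : Prop where
  nD : D.Normal
  cD : Nat.card D = 64
  zD : z ∈ D
  rD : r ∈ D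
  z1 : z ≠ 1
  r1 : r ≠ 1
  rz : r ≠ z
  zz : z * z = 1
  rr : r * r = 1
  zc : ∀ g, z * g = g * z
  rc : ∀ g, r * g = g * r
  comm : ∀ x ∈ D, ∀ y ∈ D, x * y = y * x ∨ x * y = z * (y * x)
  sq : ∀ x ∈ D, x * x = 1 ∨ x * x = z
  cen : ∀ x ∈ D, (∀ y ∈ D, x * y = y * x) → f2P z r x
  minus : ∀ x ∈ D, ∀ y ∈ D, x * x = 1 → y * y = 1 → x * y = y * x → ¬ f2P z r x →
    f2P z r y ∨ f2P z r (x * y)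
  inv : {x | x ∈ D ∧ x * x = 1}.ncard ≤ 24

section dd
set_option linter.unusedSectionVars false
variable {C : Type*} [Group C] [Finite C] {D : Subgroup C} {z r : C}

theorem F2D.pc (h : F2D D z r) {p : C} (hp : f2P z r p) (g : C) : p * g = g * p := by
  rcases hp with rfl | rfl | rfl | rfl
  · simp
  · exact h.zc g
  · exact h.rc g
  · rw [mul_assoc, h.rc, ← mul_assoc, h.zc, mul_assoc]

theorem F2D.pp (h : F2D D z r) {p : C} (hp : f2P z r p) : p * p = 1 := by
  rcases hp with rfl | rfl | rfl | rfl
  · simp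
  · exact h.zz
  · exact h.rr
  · rw [mul_assoc, h.rc, mul_assoc, h.rr, mul_one, h.zz]

theorem F2D.pD (h : F2D D z r) {p : C} (hp : f2P z r p) : p ∈ D := by
  rcases hp with rfl | rfl | rfl | rfl
  · exact D.one_mem
  · exact h.zD
  · exact h.rD
  · exact D.mul_mem h.zD h.rD

/-- product of two elements not commuting with `y` commutes with `y` -/
theorem F2D.nn (h : F2D D z r) {x x' y : C} (hx : x ∈ D) (hx' : x' ∈ D) (hy : y ∈ D)
    (h1 : x * y ≠ y * x) (h2 : x' * y ≠ y * x') : x * x' * y = y * (x * x') := by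
  have e1 := (h.comm x hx y hy).resolve_left h1
  have e2 := (h.comm x' hx' y hy).resolve_left h2
  rw [mul_assoc, e2, ← mul_assoc, ← h.zc, mul_assoc, ← mul_assoc x, e1]
  simp only [mul_assoc]
  rw [← mul_assoc z z, h.zz, one_mul]

theorem f2_cc {x x' y : C} (h1 : x * y = y * x) (h2 : x' * y = y * x') :
    x * x' * y = y * (x * x') := by
  rw [mul_assoc, h2, ← mul_assoc, h1, mul_assoc]

theorem f2_cn {x x' y : C} (h1 : x * y = y * x) (h2 : x' * y ≠ y * x') :
    x * x' * y ≠ y * (x * x') := by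
  intro e
  apply h2
  rw [← mul_assoc, ← h1, mul_assoc, mul_assoc] at e
  exact mul_left_cancel e

theorem f2_nc' {x x' y : C} (h1 : x * y ≠ y * x) (h2 : x' * y = y * x') :
    x * x' * y ≠ y * (x * x') := by
  intro e
  apply h1
  rw [mul_assoc, h2, ← mul_assoc, ← mul_assoc] at e
  exact mul_right_cancel e

/-- square of a product of commuting elements -/
theorem f2_sqc {x y : C} (h : x * y = y * x) : x * y * (x * y) = (x * x) * (y * y) := by
  rw [mul_assoc, ← mul_assoc y, ← h]; simp only [mul_assoc]

theorem F2D.sqn (h : F2D D z r) {x y : C} (hx : x ∈ D) (hy : y ∈ D) (hn : x * y ≠ y * x) :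
    x * y * (x * y) = z * ((x * x) * (y * y)) := by
  have e := (h.comm y hy x hx).resolve_left (Ne.symm hn)
  rw [mul_assoc, ← mul_assoc y, e]
  simp only [mul_assoc]
  rw [← mul_assoc x z, ← h.zc]
  simp only [mul_assoc]

/-- a second orthogonal hyperbolic pair -/
theorem F2D.second (h : F2D D z r) {a b : C} (ha : a ∈ D) (hb : b ∈ D) (hab : a * b ≠ b * a) :
    ∃ u ∈ D, ∃ v ∈ D, u * a = a * u ∧ u * b = b * u ∧ v * a = a * v ∧ v * b = b * v ∧
      u * v ≠ v * u := by
  have adj : ∀ d ∈ D, ∃ p, (p = 1 ∨ p = a ∨ p = b ∨ p = b * a) ∧ p ∈ D ∧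
      d * p * a = a * (d * p) ∧ d * p * b = b * (d * p) := by
    intro d hd
    have step : ∀ d ∈ D, d * a = a * d → ∃ p, (p = 1 ∨ p = a) ∧ p ∈ D ∧
      d * p * a = a * (d * p) ∧ d * p * b = b * (d * p) := by
      intro d hd hda
      by_cases hdb : d * b = b * d
      · exact ⟨1, Or.inl rfl, D.one_mem, by simpa using hda, by simpa using hdb⟩
      · exact ⟨a, Or.inr rfl, ha, f2_cc hda rfl, h.nn hd ha hb hdb hab⟩
    by_cases hda : d * a = a * d
    · obtain ⟨p, hp, hpD, h1, h2⟩ := step d hd hda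
      exact ⟨p, by tauto, hpD, h1, h2⟩
    · obtain ⟨p, hp, hpD, h1, h2⟩ := step (d * b) (D.mul_mem hd hb) (h.nn hd hb ha hda (Ne.symm hab))
      refine ⟨b * p, ?_, D.mul_mem hb hpD, by rwa [← mul_assoc], by rwa [← mul_assoc]⟩
      rcases hp with rfl | rfl
      · simp
      · simp
  have ex : ∃ u ∈ D, u * a = a * u ∧ u * b = b * u ∧ ¬ f2P z r u := by
    by_contra! hcon
    have sub : (D : Set C) ⊆ ((({x | f2P z r x} ∪ (· * a⁻¹) '' {x | f2P z r x}) ∪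
        (· * b⁻¹) '' {x | f2P z r x}) ∪ (· * (b * a)⁻¹) '' {x | f2P z r x}) := by
      intro d hd
      obtain ⟨p, hp, hpD, h1, h2⟩ := adj d hd
      have := hcon (d * p) (D.mul_mem hd hpD) h1 h2
      rcases hp with rfl | rfl | rfl | rfl
      · left; left; left; simpa using this
      · left; left; right; exact ⟨_, this, by simp⟩
      · left; right; exact ⟨_, this, by simp⟩
      · right; exact ⟨_, this, by group⟩
    have c := Set.ncard_le_ncard sub (Set.toFinite _)
    rw [← f2_nc, h.cD] at c
    have c1 := Set.ncard_union_le (({x | f2P z r x} ∪ (· * a⁻¹) '' {x | f2P z r x}) ∪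
        (· * b⁻¹) '' {x | f2P z r x}) ((· * (b * a)⁻¹) '' {x | f2P z r x})
    have c2 := Set.ncard_union_le ({x | f2P z r x} ∪ (· * a⁻¹) '' {x | f2P z r x})
        ((· * b⁻¹) '' {x | f2P z r x})
    have c3 := Set.ncard_union_le {x | f2P z r x} ((· * a⁻¹) '' {x | f2P z r x})
    have c4 := f2P_card z r
    have c5 : ∀ w : C, ((· * w) '' {x | f2P z r x}).ncard ≤ {x | f2P z r x}.ncard :=
      fun w => Set.ncard_image_le (Set.toFinite _)
    have c6 := c5 a⁻¹
    have c7 := c5 b⁻¹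
    have c8 := c5 (b * a)⁻¹
    omega
  obtain ⟨u, huD, hua, hub, huP⟩ := ex
  have : ∃ w ∈ D, u * w ≠ w * u := by
    by_contra! hcon
    exact huP (h.cen u huD hcon)
  obtain ⟨w, hwD, huw⟩ := this
  obtain ⟨p, hp, hpD, h1, h2⟩ := adj w hwD
  refine ⟨u, huD, w * p, D.mul_mem hwD hpD, hua, hub, h1, h2, ?_⟩
  have hpu : p * u = u * p := by
    rcases hp with rfl | rfl | rfl | rfl
    · simp
    · exact hua.symm
    · exact hub.symm
    · exact f2_cc hub.symm hua.symm
  exact Ne.symm (f2_nc' (Ne.symm huw) hpu)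

theorem F2D.exists_sing (h : F2D D z r) : ∃ a ∈ D, a * a = 1 ∧ ¬ f2P z r a := by
  have h1 : ∃ x ∈ D, ∃ y ∈ D, x * y ≠ y * x := by
    by_contra! hcon
    have sub : (D : Set C) ⊆ {x | f2P z r x} := fun x hx => h.cen x hx (hcon x hx)
    have c := Set.ncard_le_ncard sub (Set.toFinite _)
    rw [← f2_nc, h.cD] at c
    have := f2P_card z r
    omega
  obtain ⟨x, hx, y, hy, hxy⟩ := h1
  obtain ⟨u, hu, v, hv, hux, huy, hvx, hvy, huv⟩ := h.second hx hy hxy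
  rcases h.sq x hx with h2 | h2
  · exact ⟨x, hx, h2, fun hp => hxy (h.pc hp y)⟩
  rcases h.sq u hu with h3 | h3
  · exact ⟨u, hu, h3, fun hp => huv (h.pc hp v)⟩
  refine ⟨u * x, D.mul_mem hu hx, ?_, fun hp => f2_cn huy hxy (h.pc hp y)⟩
  rw [f2_sqc hux, h2, h3, h.zz]

/-- the standard generators -/
theorem F2D.gens (h : F2D D z r) : ∃ a ∈ D, ∃ b ∈ D, ∃ u ∈ D, ∃ v ∈ D,
    a * a = 1 ∧ b * b = 1 ∧ u * u = z ∧ v * v = z ∧ a * b ≠ b * a ∧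
    u * a = a * u ∧ u * b = b * u ∧ v * a = a * v ∧ v * b = b * v ∧ u * v ≠ v * u := by
  obtain ⟨a, ha, haa, haP⟩ := h.exists_sing
  have : ∃ w ∈ D, a * w ≠ w * a := by
    by_contra! hcon
    exact haP (h.cen a ha hcon)
  obtain ⟨w, hw, haw⟩ := this
  have : ∃ b ∈ D, b * b = 1 ∧ a * b ≠ b * a := by
    rcases h.sq w hw with h1 | h1
    · exact ⟨w, hw, h1, haw⟩
    · refine ⟨a * w, D.mul_mem ha hw, ?_, Ne.symm (f2_cn rfl (Ne.symm haw))⟩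
      rw [h.sqn ha hw haw, haa, h1, one_mul, h.zz]
  obtain ⟨b, hb, hbb, hab⟩ := this
  obtain ⟨u, hu, v, hv, hua, hub, hva, hvb, huv⟩ := h.second ha hb hab
  have key : ∀ w ∈ D, ∀ w' ∈ D, w * a = a * w → w * b = b * w → w * w' ≠ w' * w → w * w = z := by
    intro w hw w' hw' hwa hwb hww'
    refine (h.sq w hw).resolve_left fun e => ?_
    rcases h.minus a ha w hw haa e hwa.symm haP with h1 | h1
    · exact hww' (h.pc h1 w')
    · exact f2_nc' hab hwb (h.pc h1 b)
  exact ⟨a, ha, b, hb, u, hu, v, hv, haa, hbb, key u hu v hv hua hub huv,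
    key v hv u hu hva hvb (Ne.symm huv), hab, hua, hub, hva, hvb, huv⟩

theorem F2D.gens_ind (h : F2D D z r) {a b u v : C} (ha : a ∈ D) (hb : b ∈ D) (hu : u ∈ D)
    (hv : v ∈ D) (haa : a * a = 1) (hbb : b * b = 1) (huu : u * u = z) (hvv : v * v = z)
    (hab : a * b ≠ b * a) (hua : u * a = a * u) (hub : u * b = b * u) (hva : v * a = a * v)
    (hvb : v * b = b * v) (huv : u * v ≠ v * u) (p : C → Prop)
    (hp : ∀ x y, p x → p y → p (x * y)) (hpP : ∀ x, f2P z r x → p x)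
    (pa : p a) (pb : p b) (pu : p u) (pv : p v) : ∀ d ∈ D, p d := by
  have haP : ¬ f2P z r a := fun e => hab (h.pc e b)
  have pz : p z := hpP z (Or.inr (Or.inl rfl))
  have L4 : ∀ w ∈ D, w * a = a * w → w * b = b * w → w * u = u * w → w * v = v * w → p w := by
    intro w hw wa wb wu wv
    have key : ∀ w ∈ D, w * w = 1 → w * a = a * w → w * b = b * w → f2P z r w := by
      intro w hw ww wa wb
      rcases h.minus a ha w hw haa ww wa.symm haP with h1 | h1
      · exact h1
      · exact absurd (h.pc h1 b) (f2_nc' hab wb)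
    rcases h.sq w hw with h1 | h1
    · exact hpP w (key w hw h1 wa wb)
    · have := key (w * u) (D.mul_mem hw hu) (by rw [f2_sqc wu, h1, huu, h.zz]) (f2_cc wa hua)
        (f2_cc wb hub)
      exact absurd (h.pc this v) (f2_cn wv huv)
  have back : ∀ w x, p x → x * x = 1 ∨ x * x = z → p (w * x) → p w := by
    intro w x px hx hwx
    have h1 := hp _ _ hwx px
    rcases hx with hx | hx
    · rwa [mul_assoc, hx, mul_one] at h1
    · have h2 := hp _ _ h1 pz
      rwa [mul_assoc w, hx, mul_assoc, h.zz, mul_one] at h2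
  have L3 : ∀ w ∈ D, w * a = a * w → w * b = b * w → w * u = u * w → p w := by
    intro w hw wa wb wu
    by_cases wv : w * v = v * w
    · exact L4 w hw wa wb wu wv
    · exact back w u pu (Or.inr huu) (L4 _ (D.mul_mem hw hu) (f2_cc wa hua) (f2_cc wb hub)
        (f2_cc wu rfl) (h.nn hw hu hv wv huv))
  have L2 : ∀ w ∈ D, w * a = a * w → w * b = b * w → p w := by
    intro w hw wa wb
    by_cases wu : w * u = u * w
    · exact L3 w hw wa wb wu
    · exact back w v pv (Or.inr hvv) (L3 _ (D.mul_mem hw hv) (f2_cc wa hva) (f2_cc wb hvb)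
        (h.nn hw hv hu wu (Ne.symm huv)))
  have L1 : ∀ w ∈ D, w * a = a * w → p w := by
    intro w hw wa
    by_cases wb : w * b = b * w
    · exact L2 w hw wa wb
    · exact back w a pa (Or.inl haa) (L2 _ (D.mul_mem hw ha) (f2_cc wa rfl)
        (h.nn hw ha hb wb hab))
  intro w hw
  by_cases wa : w * a = a * w
  · exact L1 w hw wa
  · exact back w b pb (Or.inl hbb) (L1 _ (D.mul_mem hw hb) (h.nn hw hb ha wa (Ne.symm hab)))

/-- the central four-group -/
def F2D.P (h : F2D D z r) : Subgroup C where
  carrier := {x | f2P z r x}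
  one_mem' := Or.inl rfl
  mul_mem' := by
    intro x y hx hy
    have e : r * z = z * r := h.rc z
    have e1 : r * (z * r) = z := by rw [← mul_assoc, e, mul_assoc, h.rr, mul_one]
    have e2 : ∀ w, z * (z * w) = w := fun w => by rw [← mul_assoc, h.zz, one_mul]
    rcases hx with rfl | rfl | rfl | rfl <;> rcases hy with rfl | rfl | rfl | rfl <;>
      simp [f2P, mul_assoc, e, e1, e2, h.zz, h.rr]
  inv_mem' := by
    intro x hx
    have : x⁻¹ = x := inv_eq_of_mul_eq_one_left (h.pp hx)
    rw [this]; exact hx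

instance F2D.P_normal (h : F2D D z r) : h.P.Normal := by
  constructor
  intro n hn g
  have : g * n * g⁻¹ = n := by rw [← h.pc hn g]; group
  rw [this]; exact hn

theorem F2D.P_card (h : F2D D z r) : Nat.card h.P = 4 := by
  classical
  have : (h.P : Set C) = (({1, z, r, z * r} : Finset C) : Set C) := by
    ext x; simp [F2D.P, f2P]
  have hzr : z ≠ r * z := fun e => h.r1 (mul_right_cancel (b := z) (by rw [one_mul]; exact e.symm))
  rw [f2_nc, this, Set.ncard_coe_finset]
  rw [Finset.card_insert_of_notMem, Finset.card_insert_of_notMem, Finset.card_insert_of_notMem,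
    Finset.card_singleton]
  · simp [h.z1]
  · simp [h.rz.symm, h.r1]
  · simp only [Finset.mem_insert, Finset.mem_singleton, not_or]
    refine ⟨h.z1.symm, h.r1.symm, fun e => h.rz ?_⟩
    exact mul_left_cancel (e.symm.trans h.zz.symm)

/-- singular classes -/
def F2D.S (h : F2D D z r) : Set (C ⧸ h.P) :=
  {s | ∃ x ∈ D, x * x = 1 ∧ ¬ f2P z r x ∧ (x : C ⧸ h.P) = s}

theorem F2D.S_card (h : F2D D z r) : Nat.card h.S ≤ 5 := by
  let S' : Set (C ⧸ h.P) := insert 1 h.S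
  have h1 : Nat.card (QuotientGroup.mk ⁻¹' S' : Set C) = Nat.card h.P * Nat.card S' := by
    rw [← Nat.card_prod]
    exact Nat.card_congr (QuotientGroup.preimageMkEquivSubgroupProdSet h.P S')
  have h2 : (QuotientGroup.mk ⁻¹' S' : Set C) ⊆ {x | x ∈ D ∧ x * x = 1} := by
    rintro x (hx | ⟨y, hy, hyy, hyP, hx⟩)
    · have : x ∈ h.P := (QuotientGroup.eq_one_iff x).1 hx
      exact ⟨h.pD this, h.pp this⟩
    · have hp : f2P z r (y⁻¹ * x) := QuotientGroup.eq.1 hx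
      have e : x = y * (y⁻¹ * x) := by group
      refine ⟨?_, ?_⟩
      · rw [e]; exact D.mul_mem hy (h.pD hp)
      · rw [e, f2_sqc (h.pc hp y).symm, hyy, h.pp hp, one_mul]
  have h3 := (Set.ncard_le_ncard h2 (Set.toFinite _)).trans h.inv
  rw [← Nat.card_coe_set_eq, h1, h.P_card] at h3
  have h4 : Nat.card S' = Nat.card h.S + 1 := by
    rw [Nat.card_coe_set_eq, Nat.card_coe_set_eq]
    refine Set.ncard_insert_of_notMem ?_ (Set.toFinite _)
    rintro ⟨x, hx, hxx, hxP, e⟩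
    exact hxP ((QuotientGroup.eq_one_iff x).1 e)
  omega

theorem F2D.S_conj (h : F2D D z r) (g : C) (s : C ⧸ h.P) (hs : s ∈ h.S) :
    MulAut.conj (g : C ⧸ h.P) s ∈ h.S := by
  obtain ⟨x, hx, hxx, hxP, rfl⟩ := hs
  refine ⟨g * x * g⁻¹, h.nD.conj_mem x hx g, ?_, ?_, ?_⟩
  · have : g * x * g⁻¹ * (g * x * g⁻¹) = g * (x * x) * g⁻¹ := by group
    rw [this, hxx]; simp
  · intro hp
    apply hxP
    have : x = g * x * g⁻¹ := by
      have e := h.pc hp g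
      have : g * x * g⁻¹ * g = g * x := by group
      rw [this] at e
      exact mul_left_cancel e
    rw [this]; exact hp
  · simp

/-- permutation action on the singular classes -/
noncomputable def F2D.π (h : F2D D z r) : C →* Equiv.Perm h.S where
  toFun g := Equiv.Perm.subtypePerm (MulAut.conj (g : C ⧸ h.P)).toEquiv (fun s => by
    refine ⟨fun hs => ?_, fun hs => h.S_conj g s hs⟩
    have := h.S_conj g⁻¹ _ hs
    simpa [mul_assoc] using this)
  map_one' := by ext s; simp
  map_mul' g g' := by
    ext s
    change ((g * g' : C) : C ⧸ h.P) * (s : C ⧸ h.P) * ((g * g' : C) : C ⧸ h.P)⁻¹ =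
      (g : C ⧸ h.P) * ((g' : C ⧸ h.P) * (s : C ⧸ h.P) * (g' : C ⧸ h.P)⁻¹) * (g : C ⧸ h.P)⁻¹
    rw [QuotientGroup.mk_mul]
    simp only [mul_inv_rev, mul_assoc]

theorem F2D.π_apply (h : F2D D z r) (g : C) (x y : C) (hx : (x : C ⧸ h.P) ∈ h.S)
    (hy : (y : C ⧸ h.P) ∈ h.S) (e : h.π g ⟨x, hx⟩ = ⟨y, hy⟩) :
    ∃ p, f2P z r p ∧ g * x = p * (y * g) := by
  have e1 : ((g * x * g⁻¹ : C) : C ⧸ h.P) = (y : C ⧸ h.P) := by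
    have := congrArg Subtype.val e
    simpa [F2D.π] using this
  have hp : f2P z r (y⁻¹ * (g * x * g⁻¹)) := QuotientGroup.eq.1 e1.symm
  refine ⟨_, hp, ?_⟩
  rw [h.pc hp]
  have := h.pc hp g
  rw [mul_assoc, ← this]; group

end dd

section ee
set_option linter.unusedSectionVars false
variable {C : Type*} [Group C] [Finite C] {D : Subgroup C} {z r : C}
variable {U W : Type*} [AddCommGroup U] [Module (ZMod 3) U]
  [Module.Finite (ZMod 3) U] [Nontrivial U] [AddCommGroup W] [Module (ZMod 3) W]
  [Module.Finite (ZMod 3) W] [Nontrivial W]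

theorem F2D.schur (h : F2D D z r) (σ : C →* Module.End (ZMod 3) U) (hσ : σ z = -1)
    (hd : Module.finrank (ZMod 3) U = 4)
    (g : Module.End (ZMod 3) U) (hg : ∀ y ∈ D, σ y * g = g * σ y ∨ σ y * g = - (g * σ y)) :
    g = 0 ∨ ∃ x ∈ D, g = σ x := by
  have hcard : Nat.card (Subgroup.center D) ≤ 4 := by
    have h1 : Nat.card (Subgroup.center D) ≤ Nat.card h.P := by
      refine Nat.card_le_card_of_injective
        (fun x => (⟨((x : D) : C), h.cen _ (x : D).2 fun y hy => ?_⟩ : h.P)) ?_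
      · have := Subgroup.mem_center_iff.1 x.2 ⟨y, hy⟩
        exact (congrArg Subtype.val this).symm
      · intro x y e
        have := congrArg Subtype.val e
        exact Subtype.ext (Subtype.ext this)
    rwa [h.P_card] at h1
  have h2 := Subgroup.card_eq_card_quotient_mul_card_subgroup (Subgroup.center D)
  rw [h.cD] at h2
  have h3 : 4 ^ 2 ≤ Nat.card (D ⧸ Subgroup.center D) := by nlinarith
  rcases f2_schur (D := D) (z := ⟨z, h.zD⟩) (Subtype.ext h.zz) (fun x => Subtype.ext (h.zc x))
    (fun x y => (h.comm x x.2 y y.2).imp (fun e => Subtype.ext e) (fun e => Subtype.ext e))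
    (σ.comp D.subtype) hσ (by rw [hd]; exact h3) g (fun y => hg y y.2) with h4 | ⟨x, hx⟩
  · exact Or.inl h4
  · exact Or.inr ⟨x, x.2, hx⟩

theorem F2D.image_card (h : F2D D z r) (σ : C →* Module.End (ZMod 3) U) (w : C) (hw : w ∈ D)
    (hw1 : w ≠ 1) (hσ : σ w = 1) : {f | ∃ x ∈ D, σ x = f}.ncard ≤ 32 := by
  have h1 : {f | ∃ x ∈ D, σ x = f} = Units.val '' (D.map σ.toHomUnits : Set (Module.End (ZMod 3) U)ˣ) := by
    ext f
    constructor
    · rintro ⟨x, hx, rfl⟩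
      exact ⟨σ.toHomUnits x, ⟨x, hx, rfl⟩, rfl⟩
    · rintro ⟨_, ⟨x, hx, rfl⟩, rfl⟩
      exact ⟨x, hx, rfl⟩
  have : Finite (D.map σ.toHomUnits) := by
    have : Finite ((fun x => σ.toHomUnits x) '' (D : Set C)) := Set.Finite.image _ (Set.toFinite _)
    exact this
  have hf : (D.map σ.toHomUnits : Set (Module.End (ZMod 3) U)ˣ).Finite := Set.toFinite _
  rw [h1]
  refine (Set.ncard_image_le hf).trans ?_
  rw [← Nat.card_coe_set_eq]
  have h2 : Nat.card (D.map σ.toHomUnits) * Nat.card ((σ.toHomUnits.comp D.subtype).ker) = 64 := by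
    have := Subgroup.card_eq_card_quotient_mul_card_subgroup (σ.toHomUnits.comp D.subtype).ker
    rw [h.cD] at this
    rw [this, Nat.card_congr (QuotientGroup.quotientKerEquivRange (σ.toHomUnits.comp D.subtype)).toEquiv]
    have e : (σ.toHomUnits.comp D.subtype).range = D.map σ.toHomUnits := by
      rw [MonoidHom.range_comp, Subgroup.range_subtype]
    rw [e]
  have h3 : 1 < Nat.card ((σ.toHomUnits.comp D.subtype).ker) := by
    rw [Finite.one_lt_card_iff_nontrivial]
    refine ⟨⟨⟨⟨w, hw⟩, ?_⟩, 1, ?_⟩⟩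
    · rw [MonoidHom.mem_ker]
      exact Units.ext hσ
    · intro e
      exact hw1 (congrArg (fun x : (σ.toHomUnits.comp D.subtype).ker => ((x : D) : C)) e)
  change Nat.card (D.map σ.toHomUnits) ≤ 32
  nlinarith

/-- the kernel on `U` has order at most 32 -/
theorem F2D.upper (h : F2D D z r) (σ : C →* Module.End (ZMod 3) U) (σ' : C →* Module.End (ZMod 3) W)
    (hz : σ z = -1) (hr : σ r = 1) (hz' : σ' z = -1) (hr' : σ' r = -1)
    (hd' : Module.finrank (ZMod 3) W = 4) (hinj : ∀ g, σ g = 1 → σ' g = 1 → g = 1) :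
    {g | σ g = 1}.ncard ≤ 32 := by
  have h2ne : (-1 : Module.End (ZMod 3) U) ≠ 1 := by
    intro e
    obtain ⟨v, hv⟩ := exists_ne (0 : U)
    have h1 := LinearMap.congr_fun e v
    simp only [LinearMap.neg_apply, Module.End.one_apply] at h1
    have h3 : (3 : ZMod 3) • v = 0 := by
      have : (3 : ZMod 3) = 0 := rfl
      rw [this, zero_smul]
    have h4 : (3 : ZMod 3) • v = v + v + v := by
      have : (3 : ZMod 3) = 1 + 1 + 1 := by decide
      rw [this, add_smul, add_smul, one_smul]
    rw [h4] at h3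
    nth_rewrite 1 [← h1] at h3
    simp at h3
    exact hv h3
  have hD : ∀ d ∈ D, σ d = 1 → d = 1 ∨ d = r := by
    intro d hd hd1
    have hP : f2P z r d := by
      refine h.cen d hd fun y hy => (h.comm d hd y hy).resolve_right fun e => h2ne ?_
      have := congrArg σ e
      rw [map_mul, map_mul, map_mul, hd1, hz, one_mul, mul_one] at this
      have e2 : σ y * σ y⁻¹ = 1 := by rw [← map_mul, mul_inv_cancel, map_one]
      have e3 := congrArg (· * σ y⁻¹) this
      simp only [mul_assoc, e2, mul_one] at e3
      exact e3.symm
    rcases hP with e | e | e | e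
    · exact Or.inl e
    · exact absurd (by rw [← hz, ← e, hd1]) h2ne
    · exact Or.inr e
    · exact absurd (by
        have e2 := hd1
        rw [e, map_mul, hz, hr, mul_one] at e2
        exact e2) h2ne
  have hmem : ∀ g ∈ {g | σ g = 1}, σ' g ∈ {f | ∃ x ∈ D, σ' x = f} := by
    intro g hg
    have hg : σ g = 1 := hg
    have hg' : σ g⁻¹ = 1 := by
      have : σ g * σ g⁻¹ = 1 := by rw [← map_mul, mul_inv_cancel, map_one]
      rwa [hg, one_mul] at this
    have key : ∀ y ∈ D, σ' y * σ' g = σ' g * σ' y ∨ σ' y * σ' g = - (σ' g * σ' y) := by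
      intro y hy
      have hc : y * g * y⁻¹ * g⁻¹ ∈ D := by
        have : y * g * y⁻¹ * g⁻¹ = y * (g * y⁻¹ * g⁻¹) := by group
        rw [this]
        exact D.mul_mem hy (h.nD.conj_mem _ (D.inv_mem hy) g)
      have h1 : σ (y * g * y⁻¹ * g⁻¹) = 1 := by
        rw [map_mul, map_mul, map_mul, hg, hg', mul_one, mul_one, ← map_mul, mul_inv_cancel, map_one]
      have e : y * g = (y * g * y⁻¹ * g⁻¹) * (g * y) := by group
      rcases hD _ hc h1 with h2 | h2
      · left
        rw [← map_mul, e, h2, one_mul, map_mul]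
      · right
        rw [← map_mul, e, h2, map_mul, hr', map_mul, neg_one_mul]
    rcases h.schur σ' hz' hd' _ key with h0 | ⟨x, hx, e⟩
    · exfalso
      have : σ' g * σ' g⁻¹ = 1 := by rw [← map_mul, mul_inv_cancel, map_one]
      rw [h0, zero_mul] at this
      exact zero_ne_one this
    · exact ⟨x, hx, e.symm⟩
  have hfin : {f | ∃ x ∈ D, σ' x = f}.Finite :=
    (Set.toFinite (D : Set C)).image σ'
  refine (Set.ncard_le_ncard_of_injOn σ' hmem ?_ hfin).trans
    (h.image_card σ' (z * r) (D.mul_mem h.zD h.rD) ?_ (by rw [map_mul, hz', hr', neg_mul_neg, one_mul]))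
  · intro g hg g' hg' e
    have hg : σ g = 1 := hg
    have hg' : σ g' = 1 := hg'
    have := hinj (g⁻¹ * g') ?_ ?_
    · exact inv_mul_eq_one.1 this
    · have : σ g⁻¹ * σ g = 1 := by rw [← map_mul, inv_mul_cancel, map_one]
      rw [map_mul, hg', ← hg, this, hg]
    · have : σ' g⁻¹ * σ' g = 1 := by rw [← map_mul, inv_mul_cancel, map_one]
      rw [map_mul, ← e, this]
  · intro e
    apply h.rz
    exact mul_left_cancel (e.trans h.zz.symm)

end ee

section ff
set_option linter.unusedSectionVars false
variable {C : Type*} [Group C] [Finite C] {D : Subgroup C} {z r : C}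
variable {U : Type*} [AddCommGroup U] [Module (ZMod 3) U]
  [Module.Finite (ZMod 3) U] [Nontrivial U]

/-- `g` carries `x` to `y` modulo the four-group -/
def f2R (z r g x y : C) : Prop := ∃ p, f2P z r p ∧ g * x = p * (y * g)

theorem F2D.R_mul (h : F2D D z r) {g x y x' y' : C} (h1 : f2R z r g x y) (h2 : f2R z r g x' y') :
    f2R z r g (x * x') (y * y') := by
  obtain ⟨p, hp, e⟩ := h1
  obtain ⟨q, hq, e'⟩ := h2
  refine ⟨p * q, h.P.mul_mem hp hq, ?_⟩
  rw [← mul_assoc, e, mul_assoc, mul_assoc, e', ← mul_assoc y, ← h.pc hq y]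
  simp only [mul_assoc]

theorem F2D.R_p (h : F2D D z r) {g x y p : C} (h1 : f2R z r g x y) (hp : f2P z r p) :
    f2R z r g x (p * y) := by
  obtain ⟨q, hq, e⟩ := h1
  refine ⟨q * p, h.P.mul_mem hq hp, ?_⟩
  rw [e]
  have : q * p * (p * y * g) = q * (p * p) * (y * g) := by simp only [mul_assoc]
  rw [this, h.pp hp, mul_one]

theorem F2D.R_P (h : F2D D z r) {g p : C} (hp : f2P z r p) : f2R z r g p p :=
  ⟨1, Or.inl rfl, by rw [one_mul, h.pc hp]⟩

theorem F2D.R_σ (h : F2D D z r) (σ : C →* Module.End (ZMod 3) U) (hz : σ z = -1) (hr : σ r = 1)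
    {g x y : C} (h1 : f2R z r g x y) :
    σ y * σ g = σ g * σ x ∨ σ y * σ g = - (σ g * σ x) := by
  obtain ⟨p, hp, e⟩ := h1
  have e1 := congrArg σ e
  rw [map_mul, map_mul, map_mul] at e1
  rcases hp with rfl | rfl | rfl | rfl
  · left; rw [e1, map_one, one_mul]
  · right; rw [e1, hz, neg_one_mul, neg_neg]
  · left; rw [e1, hr, one_mul]
  · right; rw [e1, map_mul, hz, hr, mul_one, neg_one_mul, neg_neg]

theorem F2D.sing_abu (h : F2D D z r) {a b u v : C} (ha : a ∈ D) (hb : b ∈ D) (hu : u ∈ D)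
    (haa : a * a = 1) (hbb : b * b = 1) (huu : u * u = z)
    (hab : a * b ≠ b * a) (hua : u * a = a * u) (hub : u * b = b * u) (hva : v * a = a * v)
    (hvb : v * b = b * v) (huv : u * v ≠ v * u) : ((a * b * u : C) : C ⧸ h.P) ∈ h.S := by
  refine ⟨a * b * u, D.mul_mem (D.mul_mem ha hb) hu, ?_, fun hp => ?_, rfl⟩
  · rw [f2_sqc (f2_cc hua.symm hub.symm), h.sqn ha hb hab, haa, hbb, huu, one_mul, mul_one, h.zz]
  · exact f2_cn (f2_cc hva.symm hvb.symm) huv (h.pc hp v)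

theorem F2D.abab (h : F2D D z r) {a b : C} (ha : a ∈ D) (hb : b ∈ D)
    (haa : a * a = 1) (hbb : b * b = 1) (hab : a * b ≠ b * a) : a * b * (a * b) = z := by
  rw [h.sqn ha hb hab, haa, hbb, one_mul, mul_one]

/-- elements acting trivially on the singular classes act on `U` like elements of `D` -/
theorem F2D.ker_pi (h : F2D D z r) (σ : C →* Module.End (ZMod 3) U) (hz : σ z = -1) (hr : σ r = 1)
    (hd : Module.finrank (ZMod 3) U = 4) (n : C) (hn : h.π n = 1) : ∃ x ∈ D, σ n = σ x := by
  obtain ⟨a, ha, b, hb, u, hu, v, hv, haa, hbb, huu, hvv, hab, hua, hub, hva, hvb, huv⟩ := h.gens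
  have hS : ∀ x : C, (hx : (x : C ⧸ h.P) ∈ h.S) → f2R z r n x x := fun x hx =>
    h.π_apply n x x hx hx (by rw [hn]; rfl)
  have Sa : f2R z r n a a := hS a ⟨a, ha, haa, fun e => hab (h.pc e b), rfl⟩
  have Sb : f2R z r n b b := hS b ⟨b, hb, hbb, fun e => hab (h.pc e a).symm, rfl⟩
  have Su' := hS _ (h.sing_abu ha hb hu haa hbb huu hab hua hub hva hvb huv)
  have Sv' := hS _ (h.sing_abu ha hb hv haa hbb hvv hab hva hvb hua hub (Ne.symm huv))
  have eq : ∀ w, b * (a * (a * b * w)) = w := by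
    intro w
    simp only [mul_assoc]
    rw [← mul_assoc a a, haa, one_mul, ← mul_assoc, hbb, one_mul]
  have Su : f2R z r n u u := by
    have := h.R_mul Sb (h.R_mul Sa Su'); rwa [eq] at this
  have Sv : f2R z r n v v := by
    have := h.R_mul Sb (h.R_mul Sa Sv'); rwa [eq] at this
  have all := h.gens_ind ha hb hu hv haa hbb huu hvv hab hua hub hva hvb huv
    (fun x => f2R z r n x x) (fun x y => h.R_mul) (fun x hx => h.R_P hx) Sa Sb Su Sv
  rcases h.schur σ hz hd (σ n) (fun y hy => h.R_σ σ hz hr (all y hy)) with h0 | ⟨x, hx, e⟩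
  · exfalso
    have : σ n * σ n⁻¹ = 1 := by rw [← map_mul, mul_inv_cancel, map_one]
    rw [h0, zero_mul] at this
    exact zero_ne_one this
  · exact ⟨x, hx, e⟩

theorem f2_three (v : U) : v + v + v = 0 := by
  have h3 : (3 : ZMod 3) • v = 0 := by
    have : (3 : ZMod 3) = 0 := rfl
    rw [this, zero_smul]
  have : (3 : ZMod 3) = 1 + 1 + 1 := by decide
  rwa [this, add_smul, add_smul, one_smul] at h3

theorem F2D.no_swap (h : F2D D z r) (σ : C →* Module.End (ZMod 3) U) (hz : σ z = -1) (hr : σ r = 1)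
    (hd : Module.finrank (ZMod 3) U = 4) {M : Type*} [AddCommGroup M] (B : U →+ U →+ M)
    (hB : ∀ g u w, B (σ g u) (σ g w) = B u w) (hne : ∃ u w, B u w ≠ 0) :
    ∃ s, s ∉ h.π.range := by
  classical
  obtain ⟨a, ha, b, hb, u, hu, v, hv, haa, hbb, huu, hvv, hab, hua, hub, hva, hvb, huv⟩ := h.gens
  have Sa : (a : C ⧸ h.P) ∈ h.S := ⟨a, ha, haa, fun e => hab (h.pc e b), rfl⟩
  have Sb : (b : C ⧸ h.P) ∈ h.S := ⟨b, hb, hbb, fun e => hab (h.pc e a).symm, rfl⟩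
  have Su := h.sing_abu ha hb hu haa hbb huu hab hua hub hva hvb huv
  have Sv := h.sing_abu ha hb hv haa hbb hvv hab hva hvb hua hub (Ne.symm huv)
  refine ⟨Equiv.swap ⟨_, Sa⟩ ⟨_, Sb⟩, ?_⟩
  rintro ⟨g, hg⟩
  have Ra : f2R z r g a b := h.π_apply g a b Sa Sb (by rw [hg, Equiv.swap_apply_left])
  have Rb : f2R z r g b a := h.π_apply g b a Sb Sa (by rw [hg, Equiv.swap_apply_right])
  have neq : ∀ w w', w * a = a * w → w * b = b * w → w' * a = a * w' → w' * b = b * w' →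
      w * w' ≠ w' * w →
      ((a * b * w : C) : C ⧸ h.P) ≠ a ∧ ((a * b * w : C) : C ⧸ h.P) ≠ b := by
    intro w w' wa wb wa' wb' ww
    have hc := f2_cn (f2_cc wa'.symm wb'.symm) ww
    constructor
    · intro e
      have hp : f2P z r ((a * b * w)⁻¹ * a) := QuotientGroup.eq.1 e
      apply hc
      have e2 := h.pc hp w'
      have e3 : a * b * w = a * ((a * b * w)⁻¹ * a)⁻¹ := by group
      have e4 : ((a * b * w)⁻¹ * a)⁻¹ = (a * b * w)⁻¹ * a := inv_eq_of_mul_eq_one_left (h.pp hp)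
      rw [e3, e4]
      exact f2_cc wa'.symm e2
    · intro e
      have hp : f2P z r ((a * b * w)⁻¹ * b) := QuotientGroup.eq.1 e
      apply hc
      have e2 := h.pc hp w'
      have e3 : a * b * w = b * ((a * b * w)⁻¹ * b)⁻¹ := by group
      have e4 : ((a * b * w)⁻¹ * b)⁻¹ = (a * b * w)⁻¹ * b := inv_eq_of_mul_eq_one_left (h.pp hp)
      rw [e3, e4]
      exact f2_cc wb'.symm e2
  have fix : ∀ w, (hw : ((a * b * w : C) : C ⧸ h.P) ∈ h.S) → ((a * b * w : C) : C ⧸ h.P) ≠ a ∧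
      ((a * b * w : C) : C ⧸ h.P) ≠ b → f2R z r g w w := by
    intro w hw hne
    have R1 : f2R z r g (a * b * w) (a * b * w) := by
      refine h.π_apply g _ _ hw hw ?_
      rw [hg, Equiv.swap_apply_of_ne_of_ne]
      · exact fun e => hne.1 (congrArg Subtype.val e)
      · exact fun e => hne.2 (congrArg Subtype.val e)
    have R2 := h.R_p (h.R_mul Rb (h.R_mul Ra R1)) (p := z) (Or.inr (Or.inl rfl))
    have e1 : b * (a * (a * b * w)) = w := by
      simp only [mul_assoc]
      rw [← mul_assoc a a, haa, one_mul, ← mul_assoc, hbb, one_mul]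
    have e2 : z * (a * (b * (a * b * w))) = w := by
      have : a * (b * (a * b * w)) = a * b * (a * b) * w := by simp only [mul_assoc]
      rw [this, h.abab ha hb haa hbb hab, ← mul_assoc, h.zz, one_mul]
    rwa [e1, e2] at R2
  have Ru : f2R z r g u u := fix u Su (neq u v hua hub hva hvb huv)
  have Rv : f2R z r g v v := fix v Sv (neq v u hva hvb hua hub (Ne.symm huv))
  -- now the operators
  have hδ2 : σ (a * b) * σ (a * b) = -1 := by
    rw [← map_mul, h.abab ha hb haa hbb hab, hz]
  set δ := σ (a * b) with hδ
  have hba : b * a = z * (a * b) := (h.comm b hb a ha).resolve_left (Ne.symm hab)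
  have aδ : σ a * δ = σ b := by rw [hδ, ← map_mul, ← mul_assoc, haa, one_mul]
  have δb : δ * σ b = σ a := by rw [hδ, ← map_mul, mul_assoc, hbb, mul_one]
  have δa : δ * σ a = - σ b := by
    rw [hδ, ← map_mul, mul_assoc, hba, ← mul_assoc, ← h.zc, mul_assoc, ← mul_assoc a a, haa, one_mul,
      map_mul, hz, neg_one_mul]
  have bδ : σ b * δ = - σ a := by
    rw [hδ, ← map_mul, ← mul_assoc, hba, mul_assoc, mul_assoc, hbb, mul_one, map_mul, hz, neg_one_mul]
  have Ta : σ a * (1 - δ) = -((1 - δ) * σ b) := by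
    rw [mul_sub, sub_mul, aδ, δb]; simp
  have Tb : σ b * (1 - δ) = (1 - δ) * σ a := by
    rw [mul_sub, sub_mul, bδ, δa]; simp; abel
  have Tw : ∀ w, w * a = a * w → w * b = b * w → σ w * (1 - δ) = (1 - δ) * σ w := by
    intro w wa wb
    rw [mul_sub, sub_mul, hδ, ← map_mul, ← map_mul, f2_cc wa.symm wb.symm]; simp
  let pm : C → Prop := fun y => σ y * ((1 - δ) * σ g) = (1 - δ) * σ g * σ y ∨
    σ y * ((1 - δ) * σ g) = - ((1 - δ) * σ g * σ y)
  have pmul : ∀ x y, pm x → pm y → pm (x * y) := by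
    intro x y hx hy
    simp only [pm] at hx hy ⊢
    generalize (1 - δ) * σ g = T at *
    rw [map_mul]
    rcases hx with hx | hx <;> rcases hy with hy | hy
    · left; rw [mul_assoc, hy, ← mul_assoc, hx, mul_assoc]
    · right; rw [mul_assoc, hy, mul_neg, ← mul_assoc, hx, mul_assoc]
    · right; rw [mul_assoc, hy, ← mul_assoc, hx, neg_mul, mul_assoc]
    · left; rw [mul_assoc, hy, mul_neg, ← mul_assoc, hx, neg_mul, neg_neg, mul_assoc]
  have pP : ∀ x, f2P z r x → pm x := by
    rintro x (rfl | rfl | rfl | rfl)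
    · left; simp
    · left; simp [hz]
    · left; simp [hr]
    · left; simp [hz, hr]
  have pa : pm a := by
    rcases h.R_σ σ hz hr Ra with e | e
    · right; rw [← mul_assoc, Ta, neg_mul, mul_assoc, e, mul_assoc]
    · left; rw [← mul_assoc, Ta, neg_mul, mul_assoc, e, mul_neg, neg_neg, mul_assoc]
  have pb : pm b := by
    rcases h.R_σ σ hz hr Rb with e | e
    · left; rw [← mul_assoc, Tb, mul_assoc, e, mul_assoc]
    · right; rw [← mul_assoc, Tb, mul_assoc, e, mul_neg, mul_assoc]
  have pw : ∀ w, w * a = a * w → w * b = b * w → f2R z r g w w → pm w := by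
    intro w wa wb Rw
    rcases h.R_σ σ hz hr Rw with e | e
    · left; rw [← mul_assoc, Tw w wa wb, mul_assoc, e, mul_assoc]
    · right; rw [← mul_assoc, Tw w wa wb, mul_assoc, e, mul_neg, mul_assoc]
  have all := h.gens_ind ha hb hu hv haa hbb huu hvv hab hua hub hva hvb huv pm pmul pP pa pb
    (pw u hua hub Ru) (pw v hva hvb Rv)
  have hh : (1 + δ) * ((1 - δ) * σ g) = σ g + σ g := by
    rw [← mul_assoc]
    have : (1 + δ) * (1 - δ) = 1 + 1 := by
      rw [mul_sub, add_mul, add_mul, hδ2]; simp; abel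
    rw [this, add_mul, one_mul]
  have hsurj : ∀ w, ∃ w', σ g w' = w := by
    intro w
    refine ⟨σ g⁻¹ w, ?_⟩
    rw [← Module.End.mul_apply, ← map_mul, mul_inv_cancel, map_one]; rfl
  rcases h.schur σ hz hd _ all with h0 | ⟨x, hx, e⟩
  · rw [h0, mul_zero] at hh
    obtain ⟨w, hw⟩ := exists_ne (0 : U)
    obtain ⟨w', rfl⟩ := hsurj w
    have h1 := LinearMap.congr_fun hh w'
    have h2 := f2_three (σ g w')
    simp only [LinearMap.add_apply, LinearMap.zero_apply] at h1
    rw [← h1, zero_add] at h2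
    exact hw h2
  · rw [e] at hh
    obtain ⟨w1, w2, hw⟩ := hne
    apply hw
    have b3 : ∀ m1 m2, B m1 m2 + B m1 m2 + B m1 m2 = 0 := by
      intro m1 m2
      rw [← AddMonoidHom.add_apply, ← map_add, ← AddMonoidHom.add_apply, ← map_add, f2_three]; simp
    have bδ : ∀ m1 m2, B (m1 + δ m1) (m2 + δ m2) = B m1 m2 + B m1 m2 := by
      intro m1 m2
      have e1 : B m1 (δ m2) = - B (δ m1) m2 := by
        rw [← hB (a * b) m1 (δ m2), ← hδ, ← Module.End.mul_apply δ δ, hδ2]; simp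
      simp only [map_add, AddMonoidHom.add_apply, e1]
      rw [hδ, hB]; abel
    have h1 := LinearMap.congr_fun hh w1
    have h2 := LinearMap.congr_fun hh w2
    simp only [Module.End.mul_apply, LinearMap.add_apply, Module.End.one_apply] at h1 h2
    have h3 := bδ (σ x w1) (σ x w2)
    rw [h1, h2] at h3
    simp only [map_add, AddMonoidHom.add_apply, hB] at h3
    have h4 := b3 w1 w2
    have h5 : B w1 w2 + B w1 w2 = 0 := by
      have := h3
      simpa using this
    rwa [h5, zero_add] at h4

theorem F2D.lower (h : F2D D z r) (σ : C →* Module.End (ZMod 3) U) (hz : σ z = -1) (hr : σ r = 1)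
    (hd : Module.finrank (ZMod 3) U = 4) {M : Type*} [AddCommGroup M] (B : U →+ U →+ M)
    (hB : ∀ g u w, B (σ g u) (σ g w) = B u w) (hne : ∃ u w, B u w ≠ 0) :
    Nat.card C ≤ 1920 * {g | σ g = 1}.ncard := by
  classical
  have c1 : Nat.card h.π.range ≤ 60 := by
    obtain ⟨s, hs⟩ := h.no_swap σ hz hr hd B hB hne
    have h1 := Subgroup.card_eq_card_quotient_mul_card_subgroup h.π.range
    have h2 : 1 < Nat.card (Equiv.Perm h.S ⧸ h.π.range) := by
      rw [Finite.one_lt_card_iff_nontrivial]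
      refine ⟨⟨(s : Equiv.Perm h.S ⧸ h.π.range), ((1 : Equiv.Perm h.S) : Equiv.Perm h.S ⧸ h.π.range), fun e => hs ?_⟩⟩
      have := QuotientGroup.eq.1 e
      simpa using this
    have h3 : Nat.card (Equiv.Perm h.S) ≤ 120 := by
      rw [Nat.card_perm]
      calc _ ≤ Nat.factorial 5 := Nat.factorial_le h.S_card
        _ = 120 := rfl
    nlinarith
  have c2 : Nat.card h.π.ker ≤ 32 * {g | σ g = 1}.ncard := by
    let τ := σ.toHomUnits.comp h.π.ker.subtype
    have h1 := Subgroup.card_eq_card_quotient_mul_card_subgroup τ.ker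
    rw [Nat.card_congr (QuotientGroup.quotientKerEquivRange τ).toEquiv] at h1
    have hfin : {f | ∃ x ∈ D, σ x = f}.Finite := (Set.toFinite (D : Set C)).image σ
    have h2 : Nat.card τ.range ≤ 32 := by
      refine le_trans ?_ (h.image_card σ r h.rD h.r1 hr)
      have := hfin.to_subtype
      rw [← Nat.card_coe_set_eq]
      refine Nat.card_le_card_of_injective
        (fun t : τ.range => (⟨((t : (Module.End (ZMod 3) U)ˣ) : Module.End (ZMod 3) U), ?_⟩ :
          {f | ∃ x ∈ D, σ x = f})) ?_
      · obtain ⟨_, ⟨n, rfl⟩⟩ := t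
        obtain ⟨x, hx, e⟩ := h.ker_pi σ hz hr hd n n.2
        exact ⟨x, hx, e.symm⟩
      · intro t t' e
        have := congrArg Subtype.val e
        exact Subtype.ext (Units.ext this)
    have h3 : Nat.card τ.ker ≤ {g | σ g = 1}.ncard := by
      rw [← Nat.card_coe_set_eq]
      refine Nat.card_le_card_of_injective
        (fun t : τ.ker => (⟨((t : h.π.ker) : C), ?_⟩ : {g | σ g = 1})) ?_
      · have := MonoidHom.mem_ker.1 t.2
        exact congrArg Units.val this
      · intro t t' e
        have := congrArg Subtype.val e
        exact Subtype.ext (Subtype.ext this)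
    rw [h1]
    exact Nat.mul_le_mul h2 h3
  have h1 := Subgroup.card_eq_card_quotient_mul_card_subgroup h.π.ker
  rw [Nat.card_congr (QuotientGroup.quotientKerEquivRange h.π).toEquiv] at h1
  rw [h1]
  calc _ ≤ 60 * (32 * {g | σ g = 1}.ncard) := Nat.mul_le_mul c1 c2
    _ = _ := by ring

end ff

section gg
set_option linter.unusedSectionVars false

theorem F2E.toD {G : Type*} [Group G] [Finite G] {E : Subgroup G} {z r : G} (h : F2E E z r)
    (hz : z ∈ Subgroup.centralizer {r}) (hr : r ∈ Subgroup.centralizer {r}) :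
    F2D (E.subgroupOf (Subgroup.centralizer {r})) ⟨z, hz⟩ ⟨r, hr⟩ := by
  have hP : ∀ x : Subgroup.centralizer {r}, f2P z r x →
      f2P (⟨z, hz⟩ : Subgroup.centralizer {r}) ⟨r, hr⟩ x := by
    intro x hx
    exact hx.imp (fun e => Subtype.ext e) (fun e => e.imp (fun e => Subtype.ext e)
      (fun e => e.imp (fun e => Subtype.ext e) (fun e => Subtype.ext e)))
  have hP' : ∀ x : Subgroup.centralizer {r}, 
      f2P (⟨z, hz⟩ : Subgroup.centralizer {r}) ⟨r, hr⟩ x → f2P z r x := by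
    rintro x (rfl | rfl | rfl | rfl)
    · exact Or.inl rfl
    · exact Or.inr (Or.inl rfl)
    · exact Or.inr (Or.inr (Or.inl rfl))
    · exact Or.inr (Or.inr (Or.inr rfl))
  have hC : ∀ x : Subgroup.centralizer {r}, (x : G) * r = r * x := fun x =>
    Subgroup.mem_centralizer_singleton_iff.1 x.2
  have nE := h.nE
  exact
  { nD := inferInstance
    cD := by
      rw [← h.D_card, ← Subgroup.subgroupOf_map_subtype]
      exact (Subgroup.card_map_of_injective (Subgroup.subtype_injective _)).symm
    zD := h.zE
    rD := h.rE
    z1 := fun e => h.z1 (congrArg Subtype.val e)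
    r1 := fun e => h.r1 (congrArg Subtype.val e)
    rz := fun e => h.rz (congrArg Subtype.val e)
    zz := Subtype.ext h.zz
    rr := Subtype.ext h.rr
    zc := fun g => Subtype.ext (h.zc g)
    rc := fun g => Subtype.ext (hC g).symm
    comm := fun x hx y hy => (h.comm x hx y hy).imp (fun e => Subtype.ext e) (fun e => Subtype.ext e)
    sq := fun x hx => (h.sq x hx).imp (fun e => Subtype.ext e) (fun e => Subtype.ext e)
    cen := fun x hx hc => hP x (h.D_cen x hx (hC x) fun y hy hyr =>
      congrArg Subtype.val (hc ⟨y, Subgroup.mem_centralizer_singleton_iff.2 hyr⟩ hy))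
    minus := fun x hx y hy hxx hyy hxy hn =>
      (h.minus' x y hx hy (congrArg Subtype.val hxx) (congrArg Subtype.val hyy)
        (congrArg Subtype.val hxy) (hC x) (hC y) (fun e => hn (hP x e))).imp (hP y) (hP (x * y))
    inv := by
      refine le_trans ?_ h.D_inv
      refine Set.ncard_le_ncard_of_injOn Subtype.val ?_ (Subtype.val_injective.injOn) (Set.toFinite _)
      rintro x ⟨hx, hxx⟩
      exact ⟨hx, congrArg Subtype.val hxx, hC x⟩ }

/-- restriction of a representation to an invariant subspace -/
def f2res {X V : Type*} [Group X] [AddCommGroup V] [Module (ZMod 3) V]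
    (σ : X →* Module.End (ZMod 3) V) (U : Submodule (ZMod 3) V) (hU : ∀ g, ∀ v ∈ U, σ g v ∈ U) :
    X →* Module.End (ZMod 3) U where
  toFun g := (σ g).restrict (hU g)
  map_one' := by ext v; simp
  map_mul' g g' := by ext v; simp

theorem f2res_apply {X V : Type*} [Group X] [AddCommGroup V] [Module (ZMod 3) V]
    (σ : X →* Module.End (ZMod 3) V) (U : Submodule (ZMod 3) V) (hU : ∀ g, ∀ v ∈ U, σ g v ∈ U)
    (g : X) (u : U) : (f2res σ U hU g u : V) = σ g u := rfl

variable {G V M : Type*} [Group G] [Finite G] {E : Subgroup G} {z r : G} [AddCommGroup V]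
  [Module (ZMod 3) V] [Module.Finite (ZMod 3) V] [AddCommGroup M]

theorem F2E.z_neg (h : F2E E z r) (hV : Module.finrank (ZMod 3) V = 8)
    (ρ : G →* Module.End (ZMod 3) V) (hρ : ∀ g, ρ g = 1 → g = 1) : ρ z = -1 := by
  let V0 : Submodule (ZMod 3) V := LinearMap.ker (ρ z + 1)
  have hV0 : ∀ v, v ∈ V0 ↔ ρ z v = - v := by
    intro v
    rw [LinearMap.mem_ker, LinearMap.add_apply, Module.End.one_apply, add_eq_zero_iff_eq_neg]
  have hzz : ∀ v, ρ z (ρ z v) = v := by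
    intro v
    rw [← Module.End.mul_apply, ← map_mul, h.zz, map_one]; rfl
  have hinv : ∀ g, ∀ v ∈ V0, ρ g v ∈ V0 := by
    intro g v hv
    rw [hV0] at hv ⊢
    rw [← Module.End.mul_apply, ← map_mul, h.zc, map_mul, Module.End.mul_apply, hv, map_neg]
  have hnt : Nontrivial V0 := by
    rw [Submodule.nontrivial_iff_ne_bot]
    intro e
    apply h.z1
    apply hρ
    ext v
    have : ρ z v - v ∈ V0 := by rw [hV0, map_sub, hzz]; abel
    rw [e, Submodule.mem_bot, sub_eq_zero] at this
    exact this
  have hcard : Nat.card (Subgroup.center E) ≤ 2 := by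
    classical
    have h1 : Nat.card (Subgroup.center E) ≤ Nat.card (({1, z} : Finset G) : Set G) := by
      refine Nat.card_le_card_of_injective
        (fun x => (⟨((x : E) : G), ?_⟩ : (({1, z} : Finset G) : Set G))) ?_
      · have := h.cen _ (x : E).2 fun y hy =>
          (congrArg Subtype.val (Subgroup.mem_center_iff.1 x.2 ⟨y, hy⟩)).symm
        simpa using this
      · intro x y e
        have := congrArg Subtype.val e
        exact Subtype.ext (Subtype.ext this)
    refine h1.trans ?_
    rw [Nat.card_coe_set_eq, Set.ncard_coe_finset]
    exact Finset.card_le_two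
  have h2 := Subgroup.card_eq_card_quotient_mul_card_subgroup (Subgroup.center E)
  rw [h.cE] at h2
  have h3 : 64 ≤ Nat.card (E ⧸ Subgroup.center E) := by nlinarith
  have h4 := f2_dim (D := E) (z := ⟨z, h.zE⟩) (Subtype.ext h.zz) (fun x => Subtype.ext (h.zc x))
    (fun x y => (h.comm x x.2 y y.2).imp (fun e => Subtype.ext e) (fun e => Subtype.ext e))
    ((f2res ρ V0 hinv).comp E.subtype) (by
      ext v
      exact (hV0 v).1 v.2)
  have h5 : 8 ≤ Module.finrank (ZMod 3) V0 := by nlinarith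
  have h6 : V0 = ⊤ := Submodule.eq_top_of_finrank_eq
    (le_antisymm (Submodule.finrank_le V0) (by rw [hV]; exact h5))
  ext v
  have : v ∈ V0 := by rw [h6]; trivial
  exact (hV0 v).1 this

theorem F2E.main (h : F2E E z r) (hG : 128 * 25920 ≤ Nat.card G)
    (hV : Module.finrank (ZMod 3) V = 8)
    (ρ : G →* Module.End (ZMod 3) V) (hρ : ∀ g, ρ g = 1 → g = 1) (B : V →+ V →+ M)
    (hB : ∀ g u w, B (ρ g u) (ρ g w) = B u w) (hnd : ∀ v, (∀ w, B v w = 0) → v = 0) :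
    Nat.card {v | ρ r v = v} = 3 ^ 4 ∧
      {g | g * r = r * g ∧ ∀ v, ρ r v = v → ρ g v = v}.ncard = 32 := by
  have hz := h.z_neg hV ρ hρ
  have ntV : Nontrivial V := Module.nontrivial_of_finrank_pos (R := ZMod 3) (by omega)
  let U : Submodule (ZMod 3) V := LinearMap.ker (ρ r - 1)
  let W : Submodule (ZMod 3) V := LinearMap.ker (ρ r + 1)
  have hU : ∀ v, v ∈ U ↔ ρ r v = v := by
    intro v
    rw [LinearMap.mem_ker, LinearMap.sub_apply, Module.End.one_apply, sub_eq_zero]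
  have hW : ∀ v, v ∈ W ↔ ρ r v = - v := by
    intro v
    rw [LinearMap.mem_ker, LinearMap.add_apply, Module.End.one_apply, add_eq_zero_iff_eq_neg]
  have hrr : ∀ v, ρ r (ρ r v) = v := by
    intro v
    rw [← Module.End.mul_apply, ← map_mul, h.rr, map_one]; rfl
  have dec : ∀ v, v + ρ r v ∈ U ∧ v - ρ r v ∈ W ∧ v = -(v + ρ r v) + -(v - ρ r v) := by
    intro v
    refine ⟨?_, ?_, ?_⟩
    · rw [hU, map_add, hrr]; abel
    · rw [hW, map_sub, hrr]; abel
    · have h3 := f2_three v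
      have : -(v + ρ r v) + -(v - ρ r v) = v - (v + v + v) := by abel
      rw [this, h3, sub_zero]
  have hcompl : IsCompl U W := by
    refine ⟨?_, ?_⟩
    · rw [Submodule.disjoint_def]
      intro v h1 h2
      rw [hU] at h1
      rw [hW, h1] at h2
      have h3 := f2_three v
      nth_rewrite 1 [h2] at h3
      simpa using h3
    · rw [codisjoint_iff, eq_top_iff]
      intro v _
      obtain ⟨h1, h2, h3⟩ := dec v
      rw [h3]
      exact Submodule.add_mem_sup (U.neg_mem h1) (W.neg_mem h2)
  have hsum := Submodule.finrank_add_eq_of_isCompl hcompl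
  obtain ⟨e, heE, he, -⟩ := h.exists_e
  have he' : ∀ v, ρ r (ρ e v) = - ρ e (ρ r v) := by
    intro v
    have := congrArg ρ he
    rw [map_mul, map_mul, map_mul, hz] at this
    have h1 := LinearMap.congr_fun this v
    simp only [Module.End.mul_apply, LinearMap.neg_apply, Module.End.one_apply] at h1
    rw [h1, neg_neg]
  have inje : Function.Injective (ρ e) := by
    intro v w hvw
    have h1 := congrArg (ρ e⁻¹) hvw
    rw [← Module.End.mul_apply, ← Module.End.mul_apply, ← map_mul, inv_mul_cancel, map_one] at h1
    exact h1
  have le1 : Module.finrank (ZMod 3) U ≤ Module.finrank (ZMod 3) W := by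
    refine LinearMap.finrank_le_finrank_of_injective
      (f := (ρ e).restrict (p := U) (q := W) fun v hv => ?_) ?_
    · rw [hW, he', (hU v).1 hv]
    · intro v w hvw
      exact Subtype.ext (inje (congrArg Subtype.val hvw))
  have le2 : Module.finrank (ZMod 3) W ≤ Module.finrank (ZMod 3) U := by
    refine LinearMap.finrank_le_finrank_of_injective
      (f := (ρ e).restrict (p := W) (q := U) fun v hv => ?_) ?_
    · rw [hU, he', (hW v).1 hv, map_neg, neg_neg]
    · intro v w hvw
      exact Subtype.ext (inje (congrArg Subtype.val hvw))
  have dU : Module.finrank (ZMod 3) U = 4 := by omega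
  have dW : Module.finrank (ZMod 3) W = 4 := by omega
  have ntU : Nontrivial U := Module.nontrivial_of_finrank_pos (R := ZMod 3) (by omega)
  have ntW : Nontrivial W := Module.nontrivial_of_finrank_pos (R := ZMod 3) (by omega)
  have cr : r ∈ Subgroup.centralizer {r} := Subgroup.mem_centralizer_singleton_iff.2 rfl
  have cz : z ∈ Subgroup.centralizer {r} := Subgroup.mem_centralizer_singleton_iff.2 (h.zc r)
  have hD := h.toD cz cr
  let ρ' : Subgroup.centralizer {r} →* Module.End (ZMod 3) V :=
    ρ.comp (Subgroup.centralizer {r}).subtype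
  have hC : ∀ (x : Subgroup.centralizer {r}) v, ρ r (ρ' x v) = ρ' x (ρ r v) := by
    intro x v
    have e1 := Subgroup.mem_centralizer_singleton_iff.1 x.2
    change ρ r (ρ x v) = ρ x (ρ r v)
    rw [← Module.End.mul_apply, ← map_mul, ← e1, map_mul, Module.End.mul_apply]
  have iU : ∀ x, ∀ v ∈ U, ρ' x v ∈ U := by
    intro x v hv
    rw [hU] at hv ⊢
    rw [hC, hv]
  have iW : ∀ x, ∀ v ∈ W, ρ' x v ∈ W := by
    intro x v hv
    rw [hW] at hv ⊢
    rw [hC, hv, map_neg]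
  have zU : f2res ρ' U iU ⟨z, cz⟩ = -1 := by
    ext v
    rw [f2res_apply]
    change ρ z v = -(v : V)
    rw [hz]; rfl
  have zW : f2res ρ' W iW ⟨z, cz⟩ = -1 := by
    ext v
    rw [f2res_apply]
    change ρ z v = -(v : V)
    rw [hz]; rfl
  have rU : f2res ρ' U iU ⟨r, cr⟩ = 1 := by
    ext v
    exact (hU v).1 v.2
  have rW : f2res ρ' W iW ⟨r, cr⟩ = -1 := by
    ext v
    exact (hW v).1 v.2
  have up := hD.upper (f2res ρ' U iU) (f2res ρ' W iW) zU rU zW rW dW (by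
    intro g h1 h2
    apply Subtype.ext
    apply hρ
    ext v
    obtain ⟨m1, m2, m3⟩ := dec v
    have e1 := congrArg Subtype.val (LinearMap.congr_fun h1 ⟨_, m1⟩)
    have e2 := congrArg Subtype.val (LinearMap.congr_fun h2 ⟨_, m2⟩)
    have e1' : ρ g (v + ρ r v) = v + ρ r v := e1
    have e2' : ρ g (v - ρ r v) = v - ρ r v := e2
    conv_lhs => rw [m3]
    rw [map_add, map_neg, map_neg, e1', e2', ← m3]; rfl)
  have hne : ∃ u w : U, B u w ≠ 0 := by
    by_contra! hcon
    obtain ⟨u, hu⟩ := exists_ne (0 : U)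
    apply hu
    apply Subtype.ext
    apply hnd
    intro v
    obtain ⟨m1, m2, m3⟩ := dec v
    have e1 : B u (v + ρ r v) = 0 := hcon u ⟨_, m1⟩
    have e2 : B u (v - ρ r v) = 0 := by
      have h1 := hB r u (v - ρ r v)
      rw [(hU u).1 u.2, (hW _).1 m2, map_neg] at h1
      have h3 : B u (v - ρ r v) + B u (v - ρ r v) + B u (v - ρ r v) = 0 := by
        rw [← map_add, ← map_add, f2_three, map_zero]
      nth_rewrite 1 [← h1] at h3
      simpa using h3
    rw [m3, map_add, map_neg, map_neg, e1, e2]; simp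
  let BU : U →+ U →+ M :=
    ((AddMonoidHom.compHom' U.subtype.toAddMonoidHom).comp B).comp U.subtype.toAddMonoidHom
  have low := hD.lower (f2res ρ' U iU) zU rU dU BU (fun g u w => hB g u w) hne
  have orb := h.orbit
  have heq : {g | f2res ρ' U iU g = 1}.ncard =
      {g | g * r = r * g ∧ ∀ v, ρ r v = v → ρ g v = v}.ncard := by
    rw [← Set.ncard_image_of_injective _ Subtype.val_injective]
    congr 1
    ext g
    constructor
    · rintro ⟨x, hx, rfl⟩
      refine ⟨Subgroup.mem_centralizer_singleton_iff.1 x.2, fun v hv => ?_⟩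
      exact congrArg Subtype.val (LinearMap.congr_fun hx ⟨v, (hU v).2 hv⟩)
    · rintro ⟨h1, h2⟩
      refine ⟨⟨g, Subgroup.mem_centralizer_singleton_iff.2 h1⟩, ?_, rfl⟩
      change f2res ρ' U iU _ = 1
      ext v
      exact h2 v ((hU v).1 v.2)
  rw [heq] at low up
  refine ⟨?_, by omega⟩
  have e1 : {v | ρ r v = v} = (U : Set V) := by
    ext v; exact (hU v).symm
  rw [e1]
  change Nat.card U = _
  rw [Module.natCard_eq_pow_finrank (K := ZMod 3), dU, Nat.card_zmod]

end gg

section hh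
set_option linter.unusedSectionVars false

theorem f2_pow_cop {X : Type*} [Group X] {c : X} {n : ℕ} (h1 : c ^ (2 ^ n) = 1) (h3 : c ^ 3 = 1) :
    c = 1 := by
  have hc : Nat.Coprime (2 ^ n) 3 := Nat.Coprime.pow_left n (by norm_num)
  have := pow_gcd_eq_one.2 ⟨h1, h3⟩
  rwa [hc.gcd_eq_one, pow_one] at this

theorem f2_cop {X : Type*} [Group X] {t q c : X} (e : t * q = q * c * t) (tc : t * c = c * t)
    {n : ℕ} (tn : t ^ (2 ^ n) = 1) (c3 : c ^ 3 = 1) : c = 1 := by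
  have h : ∀ m : ℕ, t ^ m * q = q * c ^ m * t ^ m := by
    intro m
    induction m with
    | zero => simp
    | succ m ih =>
      have hc : t * c ^ m = c ^ m * t := (Commute.pow_right (show Commute t c from tc) m).eq
      calc t ^ (m + 1) * q = t * (t ^ m * q) := by rw [pow_succ', mul_assoc]
        _ = (t * q) * c ^ m * t ^ m := by rw [ih]; simp only [mul_assoc]
        _ = q * c * (t * c ^ m) * t ^ m := by rw [e]; simp only [mul_assoc]
        _ = q * c ^ (m + 1) * t ^ (m + 1) := by
          rw [hc, pow_succ', pow_succ']; simp only [mul_assoc]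
  have h1 := h (2 ^ n)
  rw [tn, one_mul, mul_one] at h1
  exact f2_pow_cop (n := n) (by simpa using h1) c3

theorem f2_O2 {X : Type*} [Group X] [Finite X] (A K : Subgroup X) (nA : A.Normal) (nK : K.Normal)
    (hA : ∀ a ∈ A, a ^ 3 = 1) (cA : Nat.card A = 243) (cK : Nat.card K = 32 * 243) (hAK : A ≤ K)
    (h1 : ∀ k ∈ K, ∀ a ∈ A, ∀ n : ℕ, k ^ (2 ^ n) = 1 → k * a = a * k)
    (h2 : ∀ k, (∀ a ∈ A, k * a = a * k) → k ∈ K) : Nat.card (Op 2 X) = 2 ^ 5 := by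
  have : Fact (Nat.Prime 2) := ⟨Nat.prime_two⟩
  obtain ⟨S0, hS0⟩ := Sylow.exists_subgroup_card_pow_prime (G := K) 2 (n := 5) (by rw [cK]; norm_num)
  let S : Subgroup X := S0.map K.subtype
  have cS : Nat.card S = 32 := by
    rw [Subgroup.card_map_of_injective (Subgroup.subtype_injective _), hS0]; norm_num
  have hSK : S ≤ K := by
    rintro _ ⟨x, -, rfl⟩
    exact x.2
  have pS : ∀ s ∈ S, s ^ (2 ^ 5) = 1 := by
    intro s hs
    have := pow_card_eq_one' (G := S) (x := ⟨s, hs⟩)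
    rw [cS] at this
    exact congrArg Subtype.val this
  have dec : ∀ k ∈ K, ∃ s ∈ S, ∃ a ∈ A, k = s * a := by
    let f : S × A → K := fun p => ⟨p.1 * p.2, K.mul_mem (hSK p.1.2) (hAK p.2.2)⟩
    have inj : Function.Injective f := by
      rintro ⟨s, a⟩ ⟨s', a'⟩ e
      have e1 : (s : X) * a = s' * a' := congrArg Subtype.val e
      have e2 : (s' : X)⁻¹ * s = a' * (a : X)⁻¹ := by
        rw [inv_mul_eq_iff_eq_mul, ← mul_assoc, ← e1]; group
      have e3 : (s' : X)⁻¹ * s = 1 := by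
        refine f2_pow_cop (n := 5) (pS _ (S.mul_mem (S.inv_mem s'.2) s.2)) ?_
        rw [e2]
        exact hA _ (A.mul_mem a'.2 (A.inv_mem a.2))
      have e4 : (s : X) = s' := (inv_mul_eq_one.1 e3).symm
      have e5 : (a : X) = a' := by
        rw [e4] at e1
        exact mul_left_cancel e1
      exact Prod.ext (Subtype.ext e4) (Subtype.ext e5)
    have bij := inj.bijective_of_nat_card_le (by rw [Nat.card_prod, cS, cA, cK])
    intro k hk
    obtain ⟨⟨s, a⟩, e⟩ := bij.2 ⟨k, hk⟩
    exact ⟨s, s.2, a, a.2, (congrArg Subtype.val e).symm⟩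
  have key : ∀ k ∈ K, ∀ n : ℕ, k ^ (2 ^ n) = 1 → k ∈ S := by
    intro k hk n hn
    obtain ⟨s, hs, a, ha, rfl⟩ := dec k hk
    have hc := h1 s (hSK hs) a ha 5 (pS s hs)
    have h3 : a ^ (2 ^ (5 + n)) = 1 := by
      have e1 : (s * a) ^ (2 ^ (5 + n)) = 1 := by
        rw [pow_add, mul_comm, pow_mul, hn, one_pow]
      rw [(show Commute s a from hc).mul_pow, pow_add, pow_mul, pS s hs, one_pow, one_mul] at e1
      rw [pow_add]; exact e1
    have h4 := f2_pow_cop h3 (hA a ha)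
    rw [h4, mul_one]; exact hs
  have nS : S.Normal := by
    constructor
    intro s hs g
    refine key _ (nK.conj_mem s (hSK hs) g) 5 ?_
    rw [conj_pow, pS s hs]; simp
  have : Op 2 X = S := by
    apply le_antisymm
    · refine sSup_le ?_
      rintro N ⟨nN, pN⟩ x hx
      obtain ⟨n, hn⟩ := pN ⟨x, hx⟩
      have hn' : x ^ (2 ^ n) = 1 := congrArg Subtype.val hn
      refine key x (h2 x fun a ha => ?_) n hn'
      have m1 : x * a * x⁻¹ * a⁻¹ ∈ A := A.mul_mem (nA.conj_mem a ha x) (A.inv_mem ha)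
      have m2 : x * a * x⁻¹ * a⁻¹ ∈ N := by
        have : x * a * x⁻¹ * a⁻¹ = x * (a * x⁻¹ * a⁻¹) := by group
        rw [this]
        exact N.mul_mem hx (nN.conj_mem _ (N.inv_mem hx) a)
      obtain ⟨m, hm⟩ := pN ⟨_, m2⟩
      have hm' : (x * a * x⁻¹ * a⁻¹) ^ (2 ^ m) = 1 := congrArg Subtype.val hm
      have e := f2_pow_cop hm' (hA _ m1)
      calc x * a = (x * a * x⁻¹ * a⁻¹) * (a * x) := by group
        _ = a * x := by rw [e, one_mul]
    · exact le_sSup ⟨nS, IsPGroup.of_card (n := 5) (by rw [cS]; norm_num)⟩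
  rw [this, cS]; norm_num

/-- the structure of `O_2(H/Q)` -/
theorem f2_mkE {G : Type*} [Group G] [Finite G] (E : Subgroup G) (nE : E.Normal) (hE : IsExtraspecial 2 E)
    (cE : Nat.card E = 2 ^ 7)
    (minus : ∀ A : Subgroup G, A ≤ E → (∀ x ∈ A, x ^ 2 = 1) → Nat.card A ≤ 2 ^ 3)
    (r : G) (hr : r ∈ E) (hrr : r * r = 1) (hrc : r ∉ Subgroup.centralizer (E : Set G)) :
    ∃ z, F2E E z r := by
  obtain ⟨-, h1, -, h2⟩ := hE
  have h3 := (Nat.card_eq_two_iff' (1 : Subgroup.center E)).1 h2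
  obtain ⟨⟨⟨z, zE⟩, zcE⟩, hz1, hz⟩ := h3
  have cen : ∀ x ∈ E, (∀ y ∈ E, x * y = y * x) → x = 1 ∨ x = z := by
    intro x hx hc
    have m : (⟨x, hx⟩ : E) ∈ Subgroup.center E :=
      Subgroup.mem_center_iff.2 fun y => Subtype.ext (hc y y.2).symm
    by_cases e : x = 1
    · exact Or.inl e
    · right
      have := hz ⟨⟨x, hx⟩, m⟩ (fun e' => e (congrArg (fun t : Subgroup.center E => ((t : E) : G)) e'))
      exact congrArg (fun t : Subgroup.center E => ((t : E) : G)) this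
  have zcom : ∀ y ∈ E, z * y = y * z := fun y hy =>
    (congrArg Subtype.val (Subgroup.mem_center_iff.1 zcE ⟨y, hy⟩)).symm
  have z1 : z ≠ 1 := fun e => hz1 (Subtype.ext (Subtype.ext e))
  have zz : z * z = 1 := by
    rcases cen (z * z) (E.mul_mem zE zE) (fun y hy => by
      rw [mul_assoc, zcom y hy, ← mul_assoc, zcom y hy, mul_assoc]) with e | e
    · exact e
    · exact absurd (mul_left_cancel (e.trans (mul_one z).symm)) z1
  have zc : ∀ g, z * g = g * z := by
    intro g
    have := cen (g * z * g⁻¹) (nE.conj_mem z zE g) (fun y hy => by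
      have e := zcom (g⁻¹ * y * g) (by simpa using nE.conj_mem y hy g⁻¹)
      calc g * z * g⁻¹ * y = g * (z * (g⁻¹ * y * g)) * g⁻¹ := by group
        _ = y * (g * z * g⁻¹) := by rw [e]; group)
    rcases this with e | e
    · exfalso
      apply z1
      calc z = g⁻¹ * (g * z * g⁻¹) * g := by group
        _ = 1 := by rw [e]; group
    · calc z * g = (g * z * g⁻¹) * g := by rw [e]
        _ = g * z := by group
  have comm : ∀ x ∈ E, ∀ y ∈ E, x * y = y * x ∨ x * y = z * (y * x) := by
    intro x hx y hy
    have m : (⟨x, hx⟩ * ⟨y, hy⟩ * ⟨x, hx⟩⁻¹ * ⟨y, hy⟩⁻¹ : E) ∈ Subgroup.center E := by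
      rw [h1]; exact Subgroup.commutator_mem_commutator trivial trivial
    have := cen (x * y * x⁻¹ * y⁻¹)
      (E.mul_mem (E.mul_mem (E.mul_mem hx hy) (E.inv_mem hx)) (E.inv_mem hy))
      (fun w hw => (congrArg Subtype.val (Subgroup.mem_center_iff.1 m ⟨w, hw⟩)).symm)
    have e' : x * y = (x * y * x⁻¹ * y⁻¹) * (y * x) := by group
    rcases this with e | e
    · left; rw [e', e, one_mul]
    · right; rw [e', e]
  have sq : ∀ x ∈ E, x * x = 1 ∨ x * x = z := by
    intro x hx
    refine cen _ (E.mul_mem hx hx) fun y hy => ?_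
    rcases comm x hx y hy with e | e
    · rw [mul_assoc, e, ← mul_assoc, e, mul_assoc]
    · rw [mul_assoc, e, ← mul_assoc, ← mul_assoc, ← zc, mul_assoc z, e,
        ← mul_assoc z z, zz, one_mul, mul_assoc]
  refine ⟨z, ?_⟩
  exact
  { nE := nE, cE := by rw [cE]; norm_num
    zE := zE, z1 := z1, zz := zz, zc := zc, comm := comm, sq := sq, cen := cen
    minus := fun A hA h => (minus A hA fun x hx => by rw [pow_two]; exact h x hx).trans (by norm_num)
    rE := hr
    r1 := by
      rintro rfl
      exact hrc (Subgroup.one_mem _)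
    rz := by
      rintro rfl
      exact hrc (Subgroup.mem_centralizer_iff.2 fun y hy => (zcom y hy).symm)
    rr := hrr }
end hh

section ii

theorem f2_final {H V : Type*} [Group H] [Finite H] [AddCommGroup V] [Module (ZMod 3) V]
    (Q : Subgroup H) [Q.Normal] (hZQ : Subgroup.center H ≤ Q)
    (cZ : Nat.card (Subgroup.center H) = 3) (h3 : ∀ x ∈ Q, x ^ 3 = 1)
    (ρ : H ⧸ Q →* Module.End (ZMod 3) V) (ι : Q →* Multiplicative V)
    (hsurj : Function.Surjective ι) (hker : ∀ x, ι x = 1 ↔ (x : H) ∈ Subgroup.center H)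
    (hρ : ∀ (h : H) (x : Q), ρ (h : H ⧸ Q) (ι x).toAdd = (ι (MulAut.conjNormal h x)).toAdd)
    (r : H) (hr : r * r = 1)
    (c1 : Nat.card {v | ρ (r : H ⧸ Q) v = v} = 3 ^ 4)
    (c2 : {g : H ⧸ Q | g * r = r * g ∧ ∀ v, ρ (r : H ⧸ Q) v = v → ρ g v = v}.ncard = 32) :
    Nat.card (Q ⊓ Subgroup.centralizer {r} : Subgroup H) = 3 ^ 5 ∧
    Nat.card (Op 2 (Subgroup.centralizer ({r} : Set H))) = 2 ^ 5 := by
  have fix : ∀ (h : H) (x : Q) (n : ℕ), h ^ (2 ^ n) = 1 →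
      ρ (h : H ⧸ Q) (ι x).toAdd = (ι x).toAdd → h * x = x * h := by
    intro h x n hn e
    rw [hρ] at e
    have e1 : ι (MulAut.conjNormal h x) = ι x := e
    have e2 : ι (x⁻¹ * MulAut.conjNormal h x) = 1 := by
      rw [map_mul, e1, ← map_mul, inv_mul_cancel, map_one]
    have e3 : (x : H)⁻¹ * (h * x * h⁻¹) ∈ Subgroup.center H := (hker _).1 e2
    have e4 := f2_cop (t := h) (q := x) (c := (x : H)⁻¹ * (h * x * h⁻¹)) (by group)
      (Subgroup.mem_center_iff.1 e3 h) hn (h3 _ (hZQ e3))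
    have e5 : h * x * h⁻¹ = x := (inv_mul_eq_one.1 e4).symm
    calc h * x = (h * x * h⁻¹) * h := by group
      _ = x * h := by rw [e5]
  have comm_fix : ∀ (h : H) (x : Q), h * x = x * h → ρ (h : H ⧸ Q) (ι x).toAdd = (ι x).toAdd := by
    intro h x e
    rw [hρ]
    congr 2
    apply Subtype.ext
    rw [MulAut.conjNormal_apply, e]; group
  have hr' : r ^ (2 ^ 1) = 1 := by rw [pow_one, pow_two, hr]
  set Q0 : Subgroup H := Q ⊓ Subgroup.centralizer {r} with hQ0
  have mQ0 : ∀ x, x ∈ Q0 ↔ x ∈ Q ∧ x * r = r * x := by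
    intro x
    rw [hQ0, Subgroup.mem_inf, Subgroup.mem_centralizer_singleton_iff]
  have cQ0 : Nat.card Q0 = 3 ^ 5 := by
    let θ : Q0 →* Multiplicative V := ι.comp (Subgroup.inclusion inf_le_left)
    have e1 := Subgroup.card_eq_card_quotient_mul_card_subgroup θ.ker
    rw [Nat.card_congr (QuotientGroup.quotientKerEquivRange θ).toEquiv] at e1
    have e2 : Nat.card θ.range = 3 ^ 4 := by
      rw [← c1]
      have : (θ.range : Set (Multiplicative V)) = {v : V | ρ (r : H ⧸ Q) v = v} := by
        ext v
        constructor
        · rintro ⟨x, rfl⟩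
          have := ((mQ0 x).1 x.2).2
          exact comm_fix r (Subgroup.inclusion inf_le_left x) this.symm
        · intro hv
          obtain ⟨x, rfl⟩ := hsurj v
          have := fix r x 1 hr' hv
          exact ⟨⟨x, (mQ0 x).2 ⟨x.2, this.symm⟩⟩, rfl⟩
      exact congrArg (fun s : Set (Multiplicative V) => Nat.card s) this
    have e3 : Nat.card θ.ker = 3 := by
      rw [← cZ]
      have hle : Subgroup.center H ≤ Q0 := fun x hx =>
        (mQ0 x).2 ⟨hZQ hx, (Subgroup.mem_center_iff.1 hx r).symm⟩
      refine Nat.card_congr (Equiv.mk (fun x => ⟨((x : Q0) : H), (hker _).1 x.2⟩)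
        (fun x => ⟨⟨(x : H), hle x.2⟩, (hker _).2 x.2⟩) (fun x => rfl) (fun x => rfl))
    rw [e1, e2, e3]; norm_num
  refine ⟨cQ0, ?_⟩
  let X := Subgroup.centralizer ({r} : Set H)
  have hX : ∀ x : X, (x : H) * r = r * x := fun x => Subgroup.mem_centralizer_singleton_iff.1 x.2
  let A : Subgroup X := Q.subgroupOf X
  have hfA : ∀ v, ρ (r : H ⧸ Q) v = v → ∃ x : Q, (ι x).toAdd = v ∧ (x : H) * r = r * x := by
    intro v hv
    obtain ⟨x, hx⟩ := hsurj (Multiplicative.ofAdd v)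
    have e : (ι x).toAdd = v := by rw [hx]; rfl
    subst e
    exact ⟨x, rfl, (fix r x 1 hr' hv).symm⟩
  let Kb : Subgroup (H ⧸ Q) :=
    { carrier := {g : H ⧸ Q | g * r = r * g ∧ ∀ v, ρ (r : H ⧸ Q) v = v → ρ g v = v}
      one_mem' := by simp
      mul_mem' := by
        rintro a b ⟨ha, ha'⟩ ⟨hb, hb'⟩
        refine ⟨f2_cc ha hb, fun v hv => ?_⟩
        rw [map_mul, Module.End.mul_apply, hb' v hv, ha' v hv]
      inv_mem' := by
        rintro a ⟨ha, ha'⟩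
        refine ⟨?_, fun v hv => ?_⟩
        · exact (Commute.inv_left (show Commute a (r : H ⧸ Q) from ha)).eq
        · conv_lhs => rw [← ha' v hv]
          rw [← Module.End.mul_apply, ← map_mul, inv_mul_cancel, map_one]; rfl }
  let φ : X →* H ⧸ Q := (QuotientGroup.mk' Q).comp X.subtype
  have hφ : ∀ x : X, φ x = ((x : H) : H ⧸ Q) := fun x => rfl
  have hφr : ∀ x : X, φ x * r = r * φ x := by
    intro x
    rw [hφ, ← QuotientGroup.mk_mul, ← QuotientGroup.mk_mul, hX]
  let K : Subgroup X := Kb.comap φ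
  have hAφ : ∀ x : X, x ∈ A ↔ φ x = 1 := fun x => (QuotientGroup.eq_one_iff (x : H)).symm
  have cA : Nat.card A = 243 := by
    have : Nat.card A = Nat.card Q0 := by
      rw [hQ0, ← Subgroup.subgroupOf_map_subtype]
      exact (Subgroup.card_map_of_injective (Subgroup.subtype_injective _)).symm
    rw [this, cQ0]; norm_num
  have hAK : A ≤ K := by
    intro x hx
    change φ x ∈ Kb
    rw [(hAφ x).1 hx]; exact Kb.one_mem
  have cK : Nat.card K = 32 * 243 := by
    let τ : K →* H ⧸ Q := φ.comp K.subtype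
    have e1 := Subgroup.card_eq_card_quotient_mul_card_subgroup τ.ker
    rw [Nat.card_congr (QuotientGroup.quotientKerEquivRange τ).toEquiv] at e1
    have e2 : τ.range = Kb := by
      ext g
      constructor
      · rintro ⟨x, rfl⟩
        exact x.2
      · intro hg
        obtain ⟨h, rfl⟩ := QuotientGroup.mk_surjective g
        have hc : (h : H ⧸ Q) * r = r * h := hg.1
        have hq : h * r * h⁻¹ * r⁻¹ ∈ Q := by
          rw [← QuotientGroup.eq_one_iff]
          simp only [QuotientGroup.mk_mul, QuotientGroup.mk_inv]
          rw [hc]; group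
        set q := h * r * h⁻¹ * r⁻¹ with hqdef
        have hrinv : r⁻¹ = r := inv_eq_of_mul_eq_one_left hr
        have eq1 : h * r * h⁻¹ = q * r := by rw [hqdef]; group
        have eq2 : q * r * (q * r) = 1 := by
          rw [← eq1]
          calc h * r * h⁻¹ * (h * r * h⁻¹) = h * (r * r) * h⁻¹ := by group
            _ = 1 := by rw [hr]; group
        have eq3 : q * q * q = 1 := by rw [← h3 q hq, pow_succ, pow_two]
        have eq4 : r * q * r = q * q := by
          have : q * (r * q * r) = q * (q * q) := by
            rw [← mul_assoc q q q, eq3, ← eq2]; simp only [mul_assoc]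
          exact mul_left_cancel this
        have eq5 : r * (q * q) * r = q := by
          calc r * (q * q) * r = r * (r * q * r) * r := by rw [eq4]
            _ = (r * r) * q * (r * r) := by simp only [mul_assoc]
            _ = q := by rw [hr]; simp
        -- the corrected lift is `q * h`
        have eq6 : (q * h) * r = r * (q * h) := by
          have a1 : h * r = q * r * h := by rw [← eq1]; group
          have a2 : r * q = q * q * r := by
            calc r * q = r * q * (r * r) := by rw [hr, mul_one]
              _ = (r * q * r) * r := by simp only [mul_assoc]
              _ = _ := by rw [eq4]
          calc q * h * r = q * (h * r) := by rw [mul_assoc]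
            _ = (q * q * r) * h := by rw [a1]; simp only [mul_assoc]
            _ = r * (q * h) := by rw [← a2, mul_assoc]
        have eq7 : ((q * h : H) : H ⧸ Q) = h := by
          rw [QuotientGroup.mk_mul, (QuotientGroup.eq_one_iff q).2 hq, one_mul]
        refine ⟨⟨⟨q * h, Subgroup.mem_centralizer_singleton_iff.2 eq6⟩, ?_⟩, eq7⟩
        change ((q * h : H) : H ⧸ Q) ∈ Kb
        rw [eq7]; exact hg
    have e3 : Nat.card Kb = 32 := by rw [← c2]; exact Nat.card_coe_set_eq _
    have e4 : Nat.card τ.ker = 243 := by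
      rw [← cA]
      exact Nat.card_congr (Equiv.mk (fun x => ⟨((x : K) : X), (hAφ _).2 x.2⟩)
        (fun x => ⟨⟨(x : X), hAK x.2⟩, (hAφ _).1 x.2⟩) (fun x => rfl) (fun x => rfl))
    rw [e1, e2, e3, e4]
  have nK : K.Normal := by
    constructor
    intro n hn g
    obtain ⟨hn1, hn2⟩ : φ n ∈ Kb := hn
    refine ⟨hφr _, fun v hv => ?_⟩
    rw [map_mul, map_mul, map_mul, map_mul, Module.End.mul_apply, Module.End.mul_apply]
    have e1 : ρ (r : H ⧸ Q) (ρ (φ g⁻¹) v) = ρ (φ g⁻¹) v := by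
      rw [← Module.End.mul_apply, ← map_mul, ← hφr, map_mul, Module.End.mul_apply, hv]
    rw [hn2 _ e1, ← Module.End.mul_apply, ← map_mul, ← map_mul, mul_inv_cancel, map_one, map_one]; rfl
  refine f2_O2 A K inferInstance nK ?_ cA cK hAK ?_ ?_
  · intro a ha
    exact Subtype.ext (h3 a ha)
  · intro k hk a ha n hn
    apply Subtype.ext
    refine fix k ⟨a, ha⟩ n (congrArg Subtype.val hn) ?_
    exact (show φ k ∈ Kb from hk).2 _ (comm_fix r ⟨a, ha⟩ (hX a).symm)
  · intro k hk
    refine ⟨hφr k, fun v hv => ?_⟩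
    obtain ⟨x, rfl, hx⟩ := hfA v hv
    have := hk ⟨x, Subgroup.mem_centralizer_singleton_iff.2 hx⟩ x.2
    exact comm_fix k x (congrArg Subtype.val this)

end ii

section jj

/-- action of `h` on `Q / [Q,Q]` -/
noncomputable def f2act {H : Type*} [Group H] (Q : Subgroup H) [Q.Normal]
    [Module (ZMod 3) (Additive (Abelianization Q))] :
    H →* Module.End (ZMod 3) (Additive (Abelianization Q)) where
  toFun h := (MonoidHom.toAdditive
    (Abelianization.map ((MulAut.conjNormal h : MulAut Q).toMonoidHom))).toZModLinearMap 3
  map_one' := by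
    apply LinearMap.ext
    intro v
    obtain ⟨x, rfl⟩ := QuotientGroup.mk_surjective (Additive.toMul v)
    apply congrArg (fun t : Q => Additive.ofMul (Abelianization.of t))
    simp
  map_mul' g g' := by
    apply LinearMap.ext
    intro v
    obtain ⟨x, hx⟩ := QuotientGroup.mk_surjective (Additive.toMul v)
    obtain rfl : Additive.ofMul (Abelianization.of x) = v := hx
    apply congrArg (fun t : Q => Additive.ofMul (Abelianization.of t))
    simp

theorem f2act_apply {H : Type*} [Group H] (Q : Subgroup H) [Q.Normal]
    [Module (ZMod 3) (Additive (Abelianization Q))] (h : H) (x : Q) :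
    f2act Q h (Additive.ofMul (Abelianization.of x)) =
      Additive.ofMul (Abelianization.of (MulAut.conjNormal h x)) := rfl

/-- the center is a commutative group -/
@[reducible] noncomputable instance f2cenComm {P : Type*} [Group P] : CommGroup (Subgroup.center P) :=
  { (inferInstance : Group (Subgroup.center P)) with
    mul_comm := fun a b => Subtype.ext (Subgroup.mem_center_iff.1 b.2 a) }

/-- commutator pairing of a class two group -/
noncomputable def f2pair {P : Type*} [Group P] (hP : commutator P ≤ Subgroup.center P) :
    P →* P →* Subgroup.center P where
  toFun x :=
    { toFun := fun y => ⟨x * y * x⁻¹ * y⁻¹,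
        hP (Subgroup.commutator_mem_commutator (Subgroup.mem_top x) (Subgroup.mem_top y))⟩
      map_one' := by apply Subtype.ext; simp
      map_mul' := by
        intro y y'
        apply Subtype.ext
        have h := Subgroup.mem_center_iff.1 (hP (Subgroup.commutator_mem_commutator
          (Subgroup.mem_top x) (Subgroup.mem_top y'))) y
        change y * (x * y' * x⁻¹ * y'⁻¹) = (x * y' * x⁻¹ * y'⁻¹) * y at h
        change x * (y * y') * x⁻¹ * (y * y')⁻¹ = (x * y * x⁻¹ * y⁻¹) * (x * y' * x⁻¹ * y'⁻¹)
        calc x * (y * y') * x⁻¹ * (y * y')⁻¹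
            = (x * y * x⁻¹ * y⁻¹) * (y * (x * y' * x⁻¹ * y'⁻¹)) * y⁻¹ := by group
          _ = _ := by rw [h]; group }
  map_one' := by
    ext y
    change 1 * y * 1⁻¹ * y⁻¹ = 1
    group
  map_mul' := by
    intro x x'
    ext y
    have h := Subgroup.mem_center_iff.1 (hP (Subgroup.commutator_mem_commutator
          (Subgroup.mem_top x') (Subgroup.mem_top y))) x
    change x * (x' * y * x'⁻¹ * y⁻¹) = (x' * y * x'⁻¹ * y⁻¹) * x at h
    change (x * x') * y * (x * x')⁻¹ * y⁻¹ = (x * y * x⁻¹ * y⁻¹) * (x' * y * x'⁻¹ * y⁻¹)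
    have h2 := Subgroup.mem_center_iff.1 (hP (Subgroup.commutator_mem_commutator
          (Subgroup.mem_top x') (Subgroup.mem_top y))) (x * y * x⁻¹ * y⁻¹)
    change (x * y * x⁻¹ * y⁻¹) * (x' * y * x'⁻¹ * y⁻¹) = (x' * y * x'⁻¹ * y⁻¹) * (x * y * x⁻¹ * y⁻¹) at h2
    calc (x * x') * y * (x * x')⁻¹ * y⁻¹ = (x * (x' * y * x'⁻¹ * y⁻¹)) * (y * x⁻¹ * y⁻¹) := by group
      _ = (x' * y * x'⁻¹ * y⁻¹) * (x * y * x⁻¹ * y⁻¹) := by rw [h]; group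
      _ = _ := h2.symm

theorem f2pair_apply {P : Type*} [Group P] (hP : commutator P ≤ Subgroup.center P) (x y : P) :
    (f2pair hP x y : P) = x * y * x⁻¹ * y⁻¹ := rfl

/-- commutator form, additively -/
noncomputable def f2form {P : Type*} [Group P] (hP : commutator P ≤ Subgroup.center P) :
    Additive (Abelianization P) →+ Additive (Abelianization P) →+ Additive (Subgroup.center P) :=
  let L : Abelianization P →* (Abelianization P →* Subgroup.center P) :=
    Abelianization.lift
      { toFun := fun x => Abelianization.lift (f2pair hP x)
        map_one' := by ext x; simp
        map_mul' := by intro x y; ext w; simp }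
  { toFun := fun v => MonoidHom.toAdditive (L v.toMul)
    map_zero' := by
      ext w
      simp
    map_add' := by
      intro v w
      ext t
      simp }

theorem f2form_apply {P : Type*} [Group P] (hP : commutator P ≤ Subgroup.center P) (x y : P) :
    f2form hP (Additive.ofMul (Abelianization.of x)) (Additive.ofMul (Abelianization.of y)) =
      Additive.ofMul (f2pair hP x y) := rfl

end jj

section kk

theorem f2_main {H : Type*} [Group H] [Finite H] (Q : Subgroup H) [Q.Normal]
    (hH : SimilarToF2Centralizer H Q) (r : H) (hr : orderOf r = 2)
    (hrO2 : (r : H ⧸ Q) ∈ Op 2 (H ⧸ Q))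
    (hrnc : (r : H ⧸ Q) ∉ Subgroup.centralizer ((Op 2 (H ⧸ Q)) : Set (H ⧸ Q))) :
    Nat.card (Q ⊓ Subgroup.centralizer {r} : Subgroup H) = 3 ^ 5 ∧
    Nat.card (Op 2 (Subgroup.centralizer ({r} : Set H))) = 2 ^ 5 := by
  obtain ⟨⟨-, hZc, -, hZ3⟩, cQ, h3, hcen, hle, hE, cE, minus, hself, ⟨iso⟩⟩ := hH
  have hrr : r * r = 1 := by rw [← pow_two, ← hr]; exact pow_orderOf_eq_one r
  have hrr' : (r : H ⧸ Q) * (r : H ⧸ Q) = 1 := by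
    rw [← QuotientGroup.mk_mul, hrr, QuotientGroup.mk_one]
  obtain ⟨z, hF⟩ := f2_mkE (Op 2 (H ⧸ Q)) (Op.normal 2 _) hE cE minus _ hrO2 hrr' hrnc
  have hP : commutator Q ≤ Subgroup.center Q := hZc.ge
  -- center of `Q` versus center of `H`
  have hcc : ∀ x : Q, x ∈ Subgroup.center Q ↔ (x : H) ∈ Subgroup.center H := by
    intro x
    constructor
    · intro hx
      rw [← hcen, Subgroup.mem_centralizer_iff]
      intro y hy
      exact congrArg Subtype.val (Subgroup.mem_center_iff.1 hx ⟨y, hy⟩)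
    · intro hx
      rw [Subgroup.mem_center_iff]
      intro y
      exact Subtype.ext (Subgroup.mem_center_iff.1 hx y)
  have cZ : Nat.card (Subgroup.center H) = 3 := by
    rw [← hZ3]
    exact Nat.card_congr
      { toFun := fun x => ⟨⟨x.1, hle x.2⟩, (hcc _).2 x.2⟩
        invFun := fun x => ⟨x.1.1, (hcc _).1 x.2⟩
        left_inv := fun x => rfl
        right_inv := fun x => rfl }
  have hof : ∀ x : Q, Abelianization.of x = 1 ↔ x ∈ Subgroup.center Q := by
    intro x
    rw [hZc]
    exact QuotientGroup.eq_one_iff x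
  have hrep : ∀ v : Additive (Abelianization Q), ∃ x : Q,
      v = Additive.ofMul (Abelianization.of x) := by
    intro v
    obtain ⟨x, hx⟩ := QuotientGroup.mk_surjective (Additive.toMul v)
    exact ⟨x, hx.symm⟩
  let : Module (ZMod 3) (Additive (Abelianization Q)) :=
    AddCommGroup.zmodModule (n := 3) (by
      intro v
      obtain ⟨x, rfl⟩ := hrep v
      rw [← ofMul_pow, ← map_pow]
      have : x ^ 3 = 1 := Subtype.ext (h3 x x.2)
      rw [this]; simp)
  have : Finite (Abelianization Q) := inferInstanceAs (Finite (Q ⧸ commutator Q))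
  have : Finite (Additive (Abelianization Q)) := inferInstanceAs (Finite (Abelianization Q))
  have : Module.Finite (ZMod 3) (Additive (Abelianization Q)) := Module.Finite.of_finite
  have cV : Nat.card (Additive (Abelianization Q)) = 3 ^ 8 := by
    have h1 := Subgroup.card_eq_card_quotient_mul_card_subgroup (commutator Q)
    rw [← hZc, hZ3, cQ] at h1
    have h2 : Nat.card (Additive (Abelianization Q)) = Nat.card (Q ⧸ Subgroup.center Q) := by
      rw [hZc]; rfl
    omega
  have hV : Module.finrank (ZMod 3) (Additive (Abelianization Q)) = 8 := by
    have h1 := Module.natCard_eq_pow_finrank (K := ZMod 3) (V := Additive (Abelianization Q))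
    rw [cV, Nat.card_zmod] at h1
    exact (Nat.pow_right_injective (by norm_num : 2 ≤ 3) h1.symm : _)
  let ρ : H ⧸ Q →* Module.End (ZMod 3) (Additive (Abelianization Q)) :=
    QuotientGroup.lift Q (f2act Q) (by
      intro q hq
      apply LinearMap.ext
      intro v
      obtain ⟨x, rfl⟩ := hrep v
      rw [f2act_apply]
      have : (MulAut.conjNormal q x : Q) = ⟨q, hq⟩ * x * ⟨q, hq⟩⁻¹ := Subtype.ext (by simp)
      rw [this]
      simp)
  have hρ : ∀ (h : H) (x : Q), ρ (h : H ⧸ Q) (Additive.ofMul (Abelianization.of x)) =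
      Additive.ofMul (Abelianization.of (MulAut.conjNormal h x)) := fun h x => rfl
  -- faithfulness
  have hcent : ∀ t : H, (∀ x : Q, ∃ c ∈ Subgroup.center H, t * x * t⁻¹ = x * c) →
      t ^ 4 = 1 → t ∈ Q := by
    intro t ht t4
    apply hle
    rw [← hcen, Subgroup.mem_centralizer_iff]
    intro q hq
    obtain ⟨c, hc, e⟩ := ht ⟨q, hq⟩
    have e' : t * q = q * c * t := by rw [← e]; group
    have := f2_cop (n := 2) e' (Subgroup.mem_center_iff.1 hc t) (by simpa using t4)
      (h3 c (hle hc))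
    rw [e', this, mul_one]
  have hker : ∀ h : H, ρ (h : H ⧸ Q) = 1 →
      ∀ x : Q, ∃ c ∈ Subgroup.center H, h * x * h⁻¹ = x * c := by
    intro h hh x
    have h1 : Abelianization.of (MulAut.conjNormal h x : Q) = Abelianization.of x := by
      have := hρ h x
      rw [hh] at this
      exact (Additive.ofMul.injective this).symm
    have h2 : Abelianization.of (x⁻¹ * (MulAut.conjNormal h x : Q)) = 1 := by
      rw [map_mul, h1, map_inv, inv_mul_cancel]
    refine ⟨_, (hcc _).1 ((hof _).1 h2), ?_⟩
    simp
  have hfE : ∀ g ∈ Op 2 (H ⧸ Q), ρ g = 1 → g = 1 := by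
    intro g hg hg1
    have g4 : g ^ 4 = 1 := by
      have : g ^ 4 = (g * g) * (g * g) := by rw [← pow_two, ← pow_two, ← pow_mul]
      rw [this]
      rcases hF.sq g hg with h | h <;> rw [h]
      · simp
      · exact hF.zz
    obtain ⟨h, rfl⟩ := QuotientGroup.mk_surjective g
    have hq : h ^ 4 ∈ Q := by
      rw [← QuotientGroup.eq_one_iff, QuotientGroup.mk_pow]; exact g4
    have ht : ((h ^ 9 : H) : H ⧸ Q) = (h : H ⧸ Q) := by
      rw [QuotientGroup.mk_pow]
      calc ((h : H ⧸ Q)) ^ 9 = ((h : H ⧸ Q) ^ 4) ^ 2 * (h : H ⧸ Q) := by group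
        _ = _ := by rw [g4]; simp
    have t4 : (h ^ 9) ^ 4 = 1 := by
      have h0 := h3 _ hq
      calc (h ^ 9) ^ 4 = ((h ^ 4) ^ 3) ^ 3 := by simp only [← pow_mul]
        _ = 1 := by rw [h0, one_pow]
    have := hcent (h ^ 9) (hker _ (by rw [ht]; exact hg1)) t4
    rw [← QuotientGroup.eq_one_iff, ht] at this
    exact this
  have hfaith : ∀ g, ρ g = 1 → g = 1 := by
    intro g hg
    refine hfE g (hself ?_) hg
    rw [Subgroup.mem_centralizer_iff]
    intro e he
    have h1 : g * e * g⁻¹ * e⁻¹ = 1 := by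
      refine hfE _ (mul_mem ((Op.normal 2 _).conj_mem e he g) (inv_mem he)) ?_
      have i1 : ρ g * ρ g⁻¹ = 1 := by rw [← map_mul]; simp
      have i2 : ρ e * ρ e⁻¹ = 1 := by rw [← map_mul]; simp
      rw [hg, one_mul] at i1
      rw [map_mul, map_mul, map_mul, hg, i1, one_mul, mul_one, i2]
    have h2 : g * e * g⁻¹ = e := by
      rw [mul_inv_eq_one] at h1; exact h1
    rw [mul_inv_eq_iff_eq_mul] at h2
    exact h2.symm
  -- the form
  have hB : ∀ g u w, f2form hP (ρ g u) (ρ g w) = f2form hP u w := by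
    intro g u w
    obtain ⟨h, rfl⟩ := QuotientGroup.mk_surjective g
    obtain ⟨x, rfl⟩ := hrep u
    obtain ⟨y, rfl⟩ := hrep w
    change Additive.ofMul (f2pair hP (MulAut.conjNormal h x) (MulAut.conjNormal h y)) =
      Additive.ofMul (f2pair hP x y)
    apply congrArg Additive.ofMul
    apply Subtype.ext
    rw [f2pair_apply, f2pair_apply]
    apply Subtype.ext
    have hc : (x * y * x⁻¹ * y⁻¹ : Q) ∈ Subgroup.center Q := (f2pair hP x y).2
    have hc' := Subgroup.mem_center_iff.1 ((hcc _).1 hc) h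
    simp only [Subgroup.coe_mul, Subgroup.coe_inv, MulAut.conjNormal_apply] at hc' ⊢
    calc _ = h * ((x : H) * y * (x : H)⁻¹ * (y : H)⁻¹) * h⁻¹ := by group
      _ = _ := by rw [hc']; group
  have hnd : ∀ v, (∀ w, f2form hP v w = 0) → v = 0 := by
    intro v hv
    obtain ⟨x, rfl⟩ := hrep v
    have : Abelianization.of x = 1 := by
      rw [hof, Subgroup.mem_center_iff]
      intro y
      have h1 := hv (Additive.ofMul (Abelianization.of y))
      rw [f2form_apply] at h1
      have h2 : x * y * x⁻¹ * y⁻¹ = 1 := congrArg Subtype.val (Additive.ofMul.injective h1)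
      rw [mul_inv_eq_one, mul_inv_eq_iff_eq_mul] at h2
      exact h2.symm
    rw [this]; rfl
  have hG : 128 * 25920 ≤ Nat.card (H ⧸ Q) := by
    rw [Subgroup.card_eq_card_quotient_mul_card_subgroup (Op 2 (H ⧸ Q)), cE,
      Nat.card_congr iso.toEquiv]
    have := f2_psp_card
    omega
  obtain ⟨c1, c2⟩ := hF.main hG hV ρ hfaith (f2form hP) hB hnd
  let ι : Q →* Multiplicative (Additive (Abelianization Q)) :=
    { toFun := fun x => Multiplicative.ofAdd (Additive.ofMul (Abelianization.of x))
      map_one' := by simp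
      map_mul' := by intro x y; simp }
  refine f2_final Q hle cZ h3 ρ ι ?_ ?_ ?_ r hrr c1 c2
  · intro v
    obtain ⟨x, hx⟩ := hrep v.toAdd
    exact ⟨x, by change Multiplicative.ofAdd _ = v; rw [← hx]; rfl⟩
  · intro x
    rw [← hcc, ← hof]
    exact Iff.rfl
  · intro h x
    rfl

end kk

/-- **Lemma 4.7(i)** (part). Let `H` be similar to a 3-centralizer in a group of type `F₂`
with `Q = O₃(H)`, and let `r ∈ H` be an involution whose image in `H/Q` lies in
`O₂(H/Q) ∖ Z(O₂(H/Q))`.  Then `|C_Q(r)| = 3⁵` and `|O₂(C_H(r))| = 2⁵`. -/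
theorem stmt_14 {H : Type*} [Group H] [Finite H] (Q : Subgroup H) [Q.Normal]
    (hH : SimilarToF2Centralizer H Q) (r : H) (hr : orderOf r = 2)
    (hrO2 : (r : H ⧸ Q) ∈ Op 2 (H ⧸ Q))
    (hrnc : (r : H ⧸ Q) ∉ Subgroup.centralizer ((Op 2 (H ⧸ Q)) : Set (H ⧸ Q))) :
    Nat.card (Q ⊓ Subgroup.centralizer {r} : Subgroup H) = 3 ^ 5 ∧
    Nat.card (Op 2 (Subgroup.centralizer ({r} : Set H))) = 2 ^ 5 := by
  exact f2_main Q hH r hr hrO2 hrnc
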